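/- Suppose p ≥ 2d + 1. Set κ := ((2+√5)(p+d)/(p−2d))·max(‖Δ‖_op, ‖Tr_d(Δ)‖_op), and suppose n > 3dκ²/(2n) + √(d/n)·κ·max_{1≤i≤n}‖Δ_i‖_op + max_{1≤i≤n}‖Δ_iᵀG‖_op + ‖Δ‖_op. Then the SDP relaxation has a unique global maximizer X̂, X̂ has rank exactly d, X̂ = R̂R̂ᵀ for some global maximizer R̂ of the program (P) with orthogonal d×d blocks, and every local maximizer S ∈ St(d,p)^{⊗n} of f satisfies SSᵀ = X̂; in particular every local maximizer of f is a global maximizer. -/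

import Mathlib

open Matrix MeasureTheory ProbabilityTheory
open scoped BigOperators ENNReal

noncomputable section

/-- Frobenius inner product `⟨X, Y⟩ = Tr (X Yᵀ)`. -/
def finner {m k : Type*} [Fintype m] [Fintype k] (X Y : Matrix m k ℝ) : ℝ :=
  ∑ i, ∑ j, X i j * Y i j

/-- Frobenius norm. -/
def frobNorm {m k : Type*} [Fintype m] [Fintype k] (X : Matrix m k ℝ) : ℝ :=
  Real.sqrt (∑ i, ∑ j, (X i j) ^ 2)

/-- Spectral (ℓ²-operator) norm of a real matrix. -/
def opNorm {m k : Type*} [Fintype m] [Fintype k] [DecidableEq k] (X : Matrix m k ℝ) : ℝ :=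
  ‖LinearMap.toContinuousLinearMap (Matrix.toEuclideanLin X)‖

/-- The `(i,j)` d×d block of an (nd)×(nd) matrix. -/
def blk {n d : ℕ} (M : Matrix (Fin n × Fin d) (Fin n × Fin d) ℝ) (i j : Fin n) :
    Matrix (Fin d) (Fin d) ℝ := fun k l => M (i, k) (j, l)

/-- The i-th d×p block row of an (nd)×p matrix. -/
def rowBlk {n d p : ℕ} (S : Matrix (Fin n × Fin d) (Fin p) ℝ) (i : Fin n) :
    Matrix (Fin d) (Fin p) ℝ := fun k l => S (i, k) l

/-- The i-th (nd)×d block column of an (nd)×(nd) matrix. -/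
def colBlk {n d : ℕ} (M : Matrix (Fin n × Fin d) (Fin n × Fin d) ℝ) (i : Fin n) :
    Matrix (Fin n × Fin d) (Fin d) ℝ := fun q l => M q (i, l)

/-- All d×p block rows lie in the Stiefel manifold St(d,p) (for p = d: are orthogonal). -/
def StiefelBlocks {n d p : ℕ} (S : Matrix (Fin n × Fin d) (Fin p) ℝ) : Prop :=
  ∀ i, rowBlk S i * (rowBlk S i)ᵀ = 1

/-- The vertical stack Z of n copies of the identity I_d. -/
def Zmat (n d : ℕ) : Matrix (Fin n × Fin d) (Fin d) ℝ := fun q l => if q.2 = l then 1 else 0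

/-- Feasibility for the SDP relaxation: symmetric, PSD, identity diagonal blocks. -/
def sdpFeasible {n d : ℕ} (X : Matrix (Fin n × Fin d) (Fin n × Fin d) ℝ) : Prop :=
  X.IsSymm ∧ X.PosSemidef ∧ ∀ i, blk X i i = 1

/-- Global maximizer of the SDP relaxation with data `A`. -/
def sdpMaximizer {n d : ℕ} (A X : Matrix (Fin n × Fin d) (Fin n × Fin d) ℝ) : Prop :=
  sdpFeasible X ∧ ∀ Y, sdpFeasible Y → finner A Y ≤ finner A X

/-- Global maximizer of the program (P) with data `A`. -/
def progPMaximizer {n d : ℕ} (A : Matrix (Fin n × Fin d) (Fin n × Fin d) ℝ)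
    (R : Matrix (Fin n × Fin d) (Fin d) ℝ) : Prop :=
  StiefelBlocks R ∧
    ∀ R' : Matrix (Fin n × Fin d) (Fin d) ℝ, StiefelBlocks R' →
      finner A (R' * R'ᵀ) ≤ finner A (R * Rᵀ)

/-- The distance `d_F(S, Z) = min_{Q ∈ St(d,p)} ‖S − ZQ‖_F`. -/
def dF {n d p : ℕ} (S : Matrix (Fin n × Fin d) (Fin p) ℝ) : ℝ :=
  sInf {c | ∃ Q : Matrix (Fin d) (Fin p) ℝ, Q * Qᵀ = 1 ∧ c = frobNorm (S - Zmat n d * Q)}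

/-- `Λ_{ii}(S) = (1/2) Σ_j (S_i S_jᵀ A_{ji} + A_{ij} S_j S_iᵀ)`. -/
def Lam {n d p : ℕ} (A : Matrix (Fin n × Fin d) (Fin n × Fin d) ℝ)
    (S : Matrix (Fin n × Fin d) (Fin p) ℝ) (i : Fin n) : Matrix (Fin d) (Fin d) ℝ :=
  (1 / 2 : ℝ) •
    ∑ j, (rowBlk S i * (rowBlk S j)ᵀ * blk A j i + blk A i j * rowBlk S j * (rowBlk S i)ᵀ)

/-- Block diagonal matrix with given d×d diagonal blocks. -/
def blkDiag {n d : ℕ} (D : Fin n → Matrix (Fin d) (Fin d) ℝ) :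
    Matrix (Fin n × Fin d) (Fin n × Fin d) ℝ :=
  fun q r => if q.1 = r.1 then D q.1 q.2 r.2 else 0

/-- Local maximizer of `f(S) = ⟨A, S Sᵀ⟩` over `St(d,p)^{⊗n}`. -/
def isLocalMax {n d p : ℕ} (A : Matrix (Fin n × Fin d) (Fin n × Fin d) ℝ)
    (S : Matrix (Fin n × Fin d) (Fin p) ℝ) : Prop :=
  StiefelBlocks S ∧ ∃ ε > (0 : ℝ), ∀ S' : Matrix (Fin n × Fin d) (Fin p) ℝ,
    StiefelBlocks S' → frobNorm (S' - S) < ε → finner A (S' * S'ᵀ) ≤ finner A (S * Sᵀ)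

/-- First-order criticality: `Σ_j A_{ij} S_j = Λ_{ii}(S) S_i` for all i. -/
def firstOrderCrit {n d p : ℕ} (A : Matrix (Fin n × Fin d) (Fin n × Fin d) ℝ)
    (S : Matrix (Fin n × Fin d) (Fin p) ℝ) : Prop :=
  ∀ i, (∑ j, blk A i j * rowBlk S j) = Lam A S i * rowBlk S i

/-- Second-order necessary inequality over tangent directions. -/
def secondOrderIneq {n d p : ℕ} (A : Matrix (Fin n × Fin d) (Fin n × Fin d) ℝ)
    (S : Matrix (Fin n × Fin d) (Fin p) ℝ) : Prop :=
  ∀ Y : Matrix (Fin n × Fin d) (Fin p) ℝ,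
    (∀ i, rowBlk S i * (rowBlk Y i)ᵀ + rowBlk Y i * (rowBlk S i)ᵀ = 0) →
    ∑ i, ∑ j, finner (blk A i j) (rowBlk Y i * (rowBlk Y j)ᵀ) ≤
      ∑ i, finner (Lam A S i) (rowBlk Y i * (rowBlk Y i)ᵀ)

/-- Second-order critical point of `f`. -/
def secondOrderCrit {n d p : ℕ} (A : Matrix (Fin n × Fin d) (Fin n × Fin d) ℝ)
    (S : Matrix (Fin n × Fin d) (Fin p) ℝ) : Prop :=
  StiefelBlocks S ∧ firstOrderCrit A S ∧ secondOrderIneq A S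

/-- Partial trace `Tr_d(Δ) ∈ ℝ^{n×n}`. -/
def partialTrace {n d : ℕ} (Δ : Matrix (Fin n × Fin d) (Fin n × Fin d) ℝ) :
    Matrix (Fin n) (Fin n) ℝ := fun i j => (blk Δ i j).trace

/-- Singular values of a d×p real matrix (square roots of the eigenvalues of `M Mᴴ`). -/
def singVals {d p : ℕ} (M : Matrix (Fin d) (Fin p) ℝ) (i : Fin d) : ℝ :=
  Real.sqrt ((Matrix.isHermitian_mul_conjTranspose_self M).eigenvalues i)

/-- Nuclear norm: sum of singular values. -/
def nuclearNorm {d p : ℕ} (M : Matrix (Fin d) (Fin p) ℝ) : ℝ :=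
  ∑ i, singVals M i

/-- The law of the iid standard Gaussian coordinates indexing the noise. -/
def gaussianEnsemble (n d : ℕ) :
    Measure (((Fin n × Fin d) × (Fin n × Fin d)) → ℝ) :=
  Measure.pi fun _ => gaussianReal 0 1

/-- The symmetric Gaussian random matrix `W` built from the iid coordinates:
`W_{ii} = 0`, the entries of `W_{ij}` for `i < j` are iid standard Gaussians, and
`W_{ji} = W_{ij}ᵀ`. -/
def Wof {n d : ℕ} (ω : ((Fin n × Fin d) × (Fin n × Fin d)) → ℝ) :
    Matrix (Fin n × Fin d) (Fin n × Fin d) ℝ :=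
  fun q r => if q.1 < r.1 then ω (q, r) else if r.1 < q.1 then ω (r, q) else 0

section Frobenius

variable {m k l : Type*} [Fintype m] [Fintype k] [Fintype l]

theorem finner_eq_trace (X Y : Matrix m k ℝ) : finner X Y = (X * Yᵀ).trace := by
  simp [finner, Matrix.trace, Matrix.mul_apply]

theorem finner_comm (X Y : Matrix m k ℝ) : finner X Y = finner Y X := by
  simp only [finner, mul_comm]

theorem finner_add_left (X Y W : Matrix m k ℝ) :
    finner (X + Y) W = finner X W + finner Y W := by
  simp only [finner, Matrix.add_apply, add_mul, Finset.sum_add_distrib]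

theorem finner_add_right (X Y W : Matrix m k ℝ) :
    finner X (Y + W) = finner X Y + finner X W := by
  simp only [finner, Matrix.add_apply, mul_add, Finset.sum_add_distrib]

theorem finner_sub_left (X Y W : Matrix m k ℝ) :
    finner (X - Y) W = finner X W - finner Y W := by
  simp only [finner, Matrix.sub_apply, sub_mul, Finset.sum_sub_distrib]

theorem finner_sub_right (X Y W : Matrix m k ℝ) :
    finner X (Y - W) = finner X Y - finner X W := by
  simp only [finner, Matrix.sub_apply, mul_sub, Finset.sum_sub_distrib]

theorem finner_smul_left (c : ℝ) (X Y : Matrix m k ℝ) :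
    finner (c • X) Y = c * finner X Y := by
  simp only [finner, Matrix.smul_apply, smul_eq_mul, mul_assoc, Finset.mul_sum]

theorem finner_smul_right (c : ℝ) (X Y : Matrix m k ℝ) :
    finner X (c • Y) = c * finner X Y := by
  rw [finner_comm, finner_smul_left, finner_comm]

theorem finner_sum_left {ι : Type*} (s : Finset ι) (X : ι → Matrix m k ℝ) (Y : Matrix m k ℝ) :
    finner (∑ i ∈ s, X i) Y = ∑ i ∈ s, finner (X i) Y := by
  simp only [finner_eq_trace, Matrix.sum_mul, Matrix.trace_sum]

theorem finner_sum_right {ι : Type*} (s : Finset ι) (X : Matrix m k ℝ) (Y : ι → Matrix m k ℝ) :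
    finner X (∑ i ∈ s, Y i) = ∑ i ∈ s, finner X (Y i) := by
  simp only [finner_comm X, finner_sum_left]

theorem finner_transpose (X Y : Matrix m k ℝ) : finner Xᵀ Yᵀ = finner X Y := by
  simp only [finner, Matrix.transpose_apply]
  exact Finset.sum_comm

theorem finner_mul_left (X : Matrix m k ℝ) (Y : Matrix k l ℝ) (W : Matrix m l ℝ) :
    finner (X * Y) W = finner Y (Xᵀ * W) := by
  rw [finner_eq_trace, finner_eq_trace, Matrix.transpose_mul, Matrix.transpose_transpose,
    ← Matrix.mul_assoc, Matrix.trace_mul_comm (Y * Wᵀ), Matrix.mul_assoc]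

theorem finner_mul_right (X : Matrix m k ℝ) (Y : Matrix k l ℝ) (W : Matrix m l ℝ) :
    finner (X * Y) W = finner X (W * Yᵀ) := by
  rw [finner_eq_trace, finner_eq_trace, Matrix.transpose_mul, Matrix.transpose_transpose,
    Matrix.mul_assoc]

theorem finner_self_nonneg (X : Matrix m k ℝ) : 0 ≤ finner X X :=
  Finset.sum_nonneg fun _ _ => Finset.sum_nonneg fun _ _ => mul_self_nonneg _

theorem finner_self_eq_zero {X : Matrix m k ℝ} (h : finner X X = 0) : X = 0 := by
  ext i j
  have h1 := (Finset.sum_eq_zero_iff_of_nonneg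
    (fun i _ => Finset.sum_nonneg fun j _ => mul_self_nonneg (X i j))).1 h i (Finset.mem_univ i)
  have h2 := (Finset.sum_eq_zero_iff_of_nonneg
    (fun j _ => mul_self_nonneg (X i j))).1 h1 j (Finset.mem_univ j)
  simpa using h2

theorem frobNorm_nonneg (X : Matrix m k ℝ) : 0 ≤ frobNorm X := Real.sqrt_nonneg _

theorem frobNorm_eq (X : Matrix m k ℝ) : frobNorm X = √(finner X X) := by
  simp only [frobNorm, finner, pow_two]

theorem frobNorm_sq (X : Matrix m k ℝ) : frobNorm X ^ 2 = finner X X := by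
  rw [frobNorm_eq, Real.sq_sqrt (finner_self_nonneg X)]

theorem finner_le (X Y : Matrix m k ℝ) : finner X Y ≤ frobNorm X * frobNorm Y := by
  have h := Real.sum_mul_le_sqrt_mul_sqrt (Finset.univ : Finset (m × k))
    (fun q => X q.1 q.2) (fun q => Y q.1 q.2)
  simpa only [finner, frobNorm, Fintype.sum_prod_type] using h

theorem finner_neg_left (X Y : Matrix m k ℝ) : finner (-X) Y = -finner X Y := by
  simp [finner]

theorem frobNorm_neg (X : Matrix m k ℝ) : frobNorm (-X) = frobNorm X := by
  simp [frobNorm]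

theorem abs_finner_le (X Y : Matrix m k ℝ) : |finner X Y| ≤ frobNorm X * frobNorm Y := by
  refine abs_le.2 ⟨?_, finner_le X Y⟩
  have := finner_le (-X) Y
  rw [finner_neg_left, frobNorm_neg] at this
  linarith

theorem frobNorm_add_le (X Y : Matrix m k ℝ) : frobNorm (X + Y) ≤ frobNorm X + frobNorm Y := by
  refine abs_le_of_sq_le_sq' ?_ (add_nonneg (frobNorm_nonneg X) (frobNorm_nonneg Y)) |>.2
  have := finner_le X Y
  rw [add_sq, frobNorm_sq, frobNorm_sq, frobNorm_sq, finner_add_left, finner_add_right,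
    finner_add_right, finner_comm Y X]
  linarith

theorem frobNorm_smul (c : ℝ) (X : Matrix m k ℝ) : frobNorm (c • X) = |c| * frobNorm X := by
  rw [frobNorm_eq, frobNorm_eq, finner_smul_left, finner_smul_right, ← mul_assoc,
    Real.sqrt_mul (mul_self_nonneg c), Real.sqrt_mul_self_eq_abs]

theorem finner_one_right [DecidableEq m] (X : Matrix m m ℝ) : finner X 1 = X.trace := by
  rw [finner_eq_trace, Matrix.transpose_one, Matrix.mul_one]

theorem finner_vecMulVec (X : Matrix m k ℝ) (x : m → ℝ) (y : k → ℝ) :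
    finner X (vecMulVec x y) = x ⬝ᵥ X *ᵥ y := by
  simp only [finner, vecMulVec_apply, dotProduct, mulVec, Finset.mul_sum]
  exact Finset.sum_congr rfl fun i _ => Finset.sum_congr rfl fun j _ => by ring

end Frobenius

section OperatorNorm

variable {m k l : Type*} [Fintype m] [Fintype k] [Fintype l] [DecidableEq k]

theorem opNorm_nonneg (X : Matrix m k ℝ) : 0 ≤ opNorm X := norm_nonneg _

theorem dotProduct_mulVec_self_le (X : Matrix m k ℝ) (v : k → ℝ) :
    (X *ᵥ v) ⬝ᵥ (X *ᵥ v) ≤ opNorm X ^ 2 * (v ⬝ᵥ v) := by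
  have h := (LinearMap.toContinuousLinearMap (Matrix.toEuclideanLin X)).le_opNorm
    (WithLp.toLp 2 v)
  have h2 := pow_le_pow_left₀ (norm_nonneg _) h 2
  rw [mul_pow, EuclideanSpace.norm_sq_eq, EuclideanSpace.norm_sq_eq] at h2
  simpa [opNorm, dotProduct, pow_two, Matrix.toLpLin_apply] using h2

theorem frobNorm_mul_le (X : Matrix m k ℝ) (V : Matrix k l ℝ) :
    frobNorm (X * V) ≤ opNorm X * frobNorm V := by
  refine abs_le_of_sq_le_sq' ?_ (mul_nonneg (opNorm_nonneg X) (frobNorm_nonneg V)) |>.2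
  rw [mul_pow, frobNorm_sq, frobNorm_sq, ← finner_transpose (X * V), ← finner_transpose V]
  have h := Finset.sum_le_sum fun j (_ : j ∈ Finset.univ) =>
    dotProduct_mulVec_self_le X (fun i => V i j)
  rw [← Finset.mul_sum] at h
  exact h

theorem abs_finner_mul_transpose_le (X : Matrix m k ℝ) (V : Matrix m l ℝ) (W : Matrix k l ℝ) :
    |finner X (V * Wᵀ)| ≤ opNorm X * frobNorm V * frobNorm W := by
  rw [← finner_mul_right]
  refine (abs_finner_le _ _).trans ?_
  have := mul_le_mul_of_nonneg_right (frobNorm_mul_le X W) (frobNorm_nonneg V)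
  linarith

end OperatorNorm

section Flow

theorem deriv_conditions_of_isLocalMax {g g₁ : ℝ → ℝ} {g₂ : ℝ} (hmax : IsLocalMax g 0)
    (hg : ∀ t, HasDerivAt g (g₁ t) t) (hg₁ : HasDerivAt g₁ g₂ 0) : g₁ 0 = 0 ∧ g₂ ≤ 0 := by
  have h0 : g₁ 0 = 0 := hmax.hasDerivAt_eq_zero (hg 0)
  refine ⟨h0, ?_⟩
  by_contra! hpos
  have hd : deriv g = g₁ := funext fun t => (hg t).deriv
  have hmin : IsLocalMin g 0 :=
    isLocalMin_of_deriv_deriv_pos (by rw [hd, hg₁.deriv]; exact hpos) (by rw [hd, h0])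
      (hg 0).continuousAt
  have hconst : g =ᶠ[nhds 0] fun _ => g 0 := by
    filter_upwards [hmax, hmin] with t h1 h2 using le_antisymm h1 h2
  have h1 : deriv g =ᶠ[nhds 0] deriv fun _ => g 0 := hconst.deriv
  have h2 := h1.deriv_eq
  rw [hd, hg₁.deriv] at h2
  simp at h2
  exact hpos.ne' h2

theorem hasDerivAt_finner_mul_transpose {m q : Type*} [Fintype m] [Fintype q]
    (A : Matrix m m ℝ) {P Q : ℝ → Matrix m q ℝ} {P' Q' : Matrix m q ℝ} {t : ℝ}
    (hP : ∀ i j, HasDerivAt (fun s => P s i j) (P' i j) t)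
    (hQ : ∀ i j, HasDerivAt (fun s => Q s i j) (Q' i j) t) :
    HasDerivAt (fun s => finner A (P s * (Q s)ᵀ)) (finner A (P' * (Q t)ᵀ + P t * Q'ᵀ)) t := by
  simp only [finner, Matrix.add_apply, Matrix.mul_apply, Matrix.transpose_apply,
    ← Finset.sum_add_distrib]
  exact HasDerivAt.fun_sum fun i _ => HasDerivAt.fun_sum fun j _ =>
    (HasDerivAt.fun_sum fun l _ => (hP i l).mul (hQ j l)).const_mul (A i j)

/-- Right multiplication of each block row by its own matrix. -/
def blkMulRight {n d p : ℕ} (S : Matrix (Fin n × Fin d) (Fin p) ℝ)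
    (Ω : Fin n → Matrix (Fin p) (Fin p) ℝ) : Matrix (Fin n × Fin d) (Fin p) ℝ :=
  fun q l => (rowBlk S q.1 * Ω q.1) q.2 l

theorem rowBlk_blkMulRight {n d p : ℕ} (S : Matrix (Fin n × Fin d) (Fin p) ℝ)
    (Ω : Fin n → Matrix (Fin p) (Fin p) ℝ) (i : Fin n) :
    rowBlk (blkMulRight S Ω) i = rowBlk S i * Ω i := rfl

open scoped Matrix.Norms.Operator in
theorem hasDerivAt_mul_exp_apply {a p : Type*} [Fintype p] [DecidableEq p]
    (S : Matrix a p ℝ) (Ω : Matrix p p ℝ) (t : ℝ) (i : a) (j : p) :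
    HasDerivAt (fun s : ℝ => (S * NormedSpace.exp (s • Ω)) i j)
      ((S * NormedSpace.exp (t • Ω) * Ω) i j) t := by
  have h := hasDerivAt_exp_smul_const (𝕂 := ℝ) Ω t
  have h2 : ∀ u v, HasDerivAt (fun s : ℝ => (NormedSpace.exp (s • Ω)) u v)
      ((NormedSpace.exp (t • Ω) * Ω) u v) t := fun u v => by
    have := (Matrix.entryLinearMap ℝ ℝ u v).toContinuousLinearMap.hasFDerivAt.comp_hasDerivAt t h
    exact this
  rw [Matrix.mul_assoc]
  exact HasDerivAt.fun_sum (u := Finset.univ) fun l _ => (h2 l j).const_mul (S i l)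

theorem exp_smul_mul_transpose {p : Type*} [Fintype p] [DecidableEq p]
    {Ω : Matrix p p ℝ} (h : Ωᵀ = -Ω) (t : ℝ) :
    NormedSpace.exp (t • Ω) * (NormedSpace.exp (t • Ω))ᵀ = 1 := by
  rw [← Matrix.exp_transpose, Matrix.transpose_smul, h, smul_neg, ← Matrix.exp_add_of_commute,
    add_neg_cancel, NormedSpace.exp_zero]
  exact (Commute.refl _).neg_right

theorem isLocalMax.variation {n d p : ℕ} {A : Matrix (Fin n × Fin d) (Fin n × Fin d) ℝ}
    {S : Matrix (Fin n × Fin d) (Fin p) ℝ} (hA : A.IsSymm) (hS : isLocalMax A S)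
    {Ω : Fin n → Matrix (Fin p) (Fin p) ℝ} (hΩ : ∀ i, (Ω i)ᵀ = -Ω i) :
    finner (A * S) (blkMulRight S Ω) = 0 ∧
      finner A (blkMulRight S Ω * (blkMulRight S Ω)ᵀ) +
        finner (A * S) (blkMulRight (blkMulRight S Ω) Ω) ≤ 0 := by
  obtain ⟨hst, ε, hε, hloc⟩ := hS
  set F : ℝ → Matrix (Fin n × Fin d) (Fin p) ℝ :=
    fun t => blkMulRight S fun i => NormedSpace.exp (t • Ω i) with hF
  have hF0 : F 0 = S := by
    ext q l
    simp only [hF, blkMulRight, zero_smul, NormedSpace.exp_zero, Matrix.mul_one]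
    rfl
  have hFst : ∀ t, StiefelBlocks (F t) := fun t i => by
    rw [hF, rowBlk_blkMulRight, Matrix.transpose_mul, Matrix.mul_assoc,
      ← Matrix.mul_assoc _ _ (rowBlk S i)ᵀ,
      exp_smul_mul_transpose (hΩ i), Matrix.one_mul, hst i]
  have hF1 : ∀ t i j, HasDerivAt (fun s => F s i j) (blkMulRight (F t) Ω i j) t :=
    fun t i j => hasDerivAt_mul_exp_apply (rowBlk S i.1) (Ω i.1) t i.2 j
  have hF2 : ∀ t i j, HasDerivAt (fun s => blkMulRight (F s) Ω i j)
      (blkMulRight (blkMulRight (F t) Ω) Ω i j) t := fun t i j =>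
    HasDerivAt.fun_sum (u := Finset.univ) fun l _ => (hF1 t (i.1, i.2) l).mul_const (Ω i.1 l j)
  have hcont : Filter.Tendsto (fun t => frobNorm (F t - S)) (nhds 0) (nhds 0) := by
    have : Continuous fun t => frobNorm (F t - S) := by
      have : ∀ i j, Continuous fun t => F t i j := fun i j =>
        continuous_iff_continuousAt.2 fun t => (hF1 t i j).continuousAt
      simp only [frobNorm, Matrix.sub_apply]
      fun_prop
    simpa [hF0, frobNorm] using this.tendsto 0
  have hmax : IsLocalMax (fun t => finner A (F t * (F t)ᵀ)) 0 := by
    filter_upwards [hcont.eventually (gt_mem_nhds hε)] with t ht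
    rw [hF0]
    exact hloc _ (hFst t) ht
  have key := deriv_conditions_of_isLocalMax hmax
    (fun t => hasDerivAt_finner_mul_transpose A (hF1 t) (hF1 t))
    (by
      simp only [finner_add_right]
      exact (hasDerivAt_finner_mul_transpose A (hF2 0) (hF1 0)).add
        (hasDerivAt_finner_mul_transpose A (hF1 0) (hF2 0)))
  have hswap : ∀ V W : Matrix (Fin n × Fin d) (Fin p) ℝ,
      finner A (V * Wᵀ) = finner (A * W) V := fun V W => (finner_mul_right A W V).symm
  have hswap' : ∀ V W : Matrix (Fin n × Fin d) (Fin p) ℝ,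
      finner A (W * Vᵀ) = finner (A * W) V := fun V W => by
    rw [← finner_transpose, hA.eq, Matrix.transpose_mul, Matrix.transpose_transpose, hswap]
  simp only [hF0, finner_add_right] at key
  rw [hswap, hswap'] at key
  rw [hswap (blkMulRight (blkMulRight S Ω) Ω), hswap' (blkMulRight (blkMulRight S Ω) Ω)] at key
  constructor <;> linarith [key.1, key.2]

end Flow

section Critical

variable {n d p : ℕ}

theorem finner_eq_sum_rowBlk (X Y : Matrix (Fin n × Fin d) (Fin p) ℝ) :
    finner X Y = ∑ i, finner (rowBlk X i) (rowBlk Y i) :=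
  Fintype.sum_prod_type _

theorem finner_eq_sum_blk (X Y : Matrix (Fin n × Fin d) (Fin n × Fin d) ℝ) :
    finner X Y = ∑ i, ∑ j, finner (blk X i j) (blk Y i j) := by
  simp only [finner, Fintype.sum_prod_type, blk]
  exact Finset.sum_congr rfl fun i _ => Finset.sum_comm

theorem blk_mul_transpose {q : ℕ} (V W : Matrix (Fin n × Fin d) (Fin q) ℝ) (i j : Fin n) :
    blk (V * Wᵀ) i j = rowBlk V i * (rowBlk W j)ᵀ := rfl

theorem blk_add (X Y : Matrix (Fin n × Fin d) (Fin n × Fin d) ℝ) (i j : Fin n) :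
    blk (X + Y) i j = blk X i j + blk Y i j := rfl

theorem isLocalMax.first_order {A : Matrix (Fin n × Fin d) (Fin n × Fin d) ℝ}
    {S : Matrix (Fin n × Fin d) (Fin p) ℝ} (hA : A.IsSymm) (hS : isLocalMax A S) (i : Fin n) :
    (rowBlk (A * S) i * (rowBlk S i)ᵀ).IsSymm ∧
      rowBlk (A * S) i * (rowBlk S i)ᵀ * rowBlk S i = rowBlk (A * S) i := by
  set B := rowBlk (A * S) i with hB
  set N := (rowBlk S i)ᵀ * B with hN
  have hst := hS.1 i
  have hvar := (hS.variation hA (Ω := Pi.single i (N - Nᵀ)) (fun j => by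
    by_cases h : j = i
    · subst h; simp
    · simp [h])).1
  have hNN : finner N (N - Nᵀ) = 0 := by
    rw [finner_eq_sum_rowBlk, Finset.sum_eq_single i] at hvar
    · rwa [rowBlk_blkMulRight, Pi.single_eq_same, ← hB, finner_comm, finner_mul_left,
        finner_comm] at hvar
    · intro j _ hj
      rw [rowBlk_blkMulRight, Pi.single_eq_of_ne hj, Matrix.mul_zero]
      simp [finner]
    · simp
  have hsymm : N - Nᵀ = 0 := by
    apply finner_self_eq_zero
    have h2 : finner Nᵀ (N - Nᵀ) = - finner N (N - Nᵀ) := by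
      rw [← finner_transpose, Matrix.transpose_sub, Matrix.transpose_transpose, finner_sub_right,
        finner_sub_right]
      ring
    rw [finner_sub_left, h2, hNN]
    ring
  have hNs : (rowBlk S i)ᵀ * B = Bᵀ * rowBlk S i := by
    have := sub_eq_zero.1 hsymm
    rwa [hN, Matrix.transpose_mul, Matrix.transpose_transpose] at this
  have hBeq : B = rowBlk S i * Bᵀ * rowBlk S i := by
    rw [Matrix.mul_assoc, ← hNs, ← Matrix.mul_assoc, hst, Matrix.one_mul]
  have hsym : B * (rowBlk S i)ᵀ = rowBlk S i * Bᵀ := by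
    conv_lhs => rw [hBeq]
    rw [Matrix.mul_assoc, hst, Matrix.mul_one]
  refine ⟨?_, ?_⟩
  · rw [Matrix.IsSymm, Matrix.transpose_mul, Matrix.transpose_transpose, hsym]
  · rw [hsym, ← hBeq]

theorem isLocalMax.second_order {A : Matrix (Fin n × Fin d) (Fin n × Fin d) ℝ}
    {S : Matrix (Fin n × Fin d) (Fin p) ℝ} (hA : A.IsSymm) (hS : isLocalMax A S)
    {Ω : Fin n → Matrix (Fin p) (Fin p) ℝ} (hΩ : ∀ i, (Ω i)ᵀ = -Ω i) :
    finner A (blkMulRight S Ω * (blkMulRight S Ω)ᵀ) ≤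
      ∑ i, finner (rowBlk (A * S) i * (rowBlk S i)ᵀ)
        (rowBlk S i * Ω i * (rowBlk S i * Ω i)ᵀ) := by
  have h := (hS.variation hA hΩ).2
  have h2 : finner (A * S) (blkMulRight (blkMulRight S Ω) Ω) =
      -∑ i, finner (rowBlk (A * S) i * (rowBlk S i)ᵀ)
        (rowBlk S i * Ω i * (rowBlk S i * Ω i)ᵀ) := by
    rw [finner_eq_sum_rowBlk, ← Finset.sum_neg_distrib]
    refine Finset.sum_congr rfl fun i _ => ?_
    have e : rowBlk S i * Ω i * Ω i * (rowBlk S i)ᵀ =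
        -(rowBlk S i * Ω i * (rowBlk S i * Ω i)ᵀ) := by
      rw [Matrix.transpose_mul, hΩ i]
      simp [Matrix.mul_assoc]
    have e2 := congrArg (finner · (rowBlk S i * Ω i * Ω i)) (hS.first_order hA i).2
    rw [rowBlk_blkMulRight, rowBlk_blkMulRight, ← e2, finner_mul_right, e, finner_comm,
      finner_neg_left, finner_comm]
  linarith

/-- Lagrange multipliers at a local maximizer dominate the diagonal blocks of the data. -/
theorem isLocalMax.multiplier_nonneg {A : Matrix (Fin n × Fin d) (Fin n × Fin d) ℝ}
    {S : Matrix (Fin n × Fin d) (Fin p) ℝ} (hA : A.IsSymm) (hS : isLocalMax A S) (hdp : d < p)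
    {i : Fin n} (hAi : blk A i i = 1) (x : Fin d → ℝ) :
    0 ≤ x ⬝ᵥ (rowBlk (A * S) i * (rowBlk S i)ᵀ) *ᵥ x := by
  have hker : LinearMap.ker (rowBlk S i).mulVecLin ≠ ⊥ :=
    LinearMap.ker_ne_bot_of_finrank_lt (by simpa using hdp)
  obtain ⟨v, hv, hv0⟩ := (Submodule.ne_bot_iff _).1 hker
  replace hv : rowBlk S i *ᵥ v = 0 := by simpa using hv
  have hvv : 0 < v ⬝ᵥ v := by
    refine lt_of_le_of_ne (Finset.sum_nonneg fun _ _ => mul_self_nonneg _) fun h => hv0 ?_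
    exact dotProduct_self_eq_zero.1 h.symm
  set Ω : Matrix (Fin p) (Fin p) ℝ :=
    (rowBlk S i)ᵀ * vecMulVec x v - (vecMulVec x v)ᵀ * rowBlk S i with hΩ
  have hSΩ : rowBlk S i * Ω = vecMulVec x v := by
    rw [hΩ, Matrix.mul_sub, ← Matrix.mul_assoc, hS.1 i, Matrix.one_mul, ← Matrix.mul_assoc,
      transpose_vecMulVec, mul_vecMulVec, hv]
    simp
  have hso := hS.second_order hA (Ω := Pi.single i Ω) (fun j => by
    by_cases h : j = i
    · subst h; simp [hΩ, Matrix.transpose_mul]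
    · simp [h])
  have hxx : vecMulVec x v * (vecMulVec x v)ᵀ = (v ⬝ᵥ v) • vecMulVec x x := by
    rw [transpose_vecMulVec, vecMulVec_mul_vecMulVec, vecMulVec_smul]
  rw [Finset.sum_eq_single i, finner_eq_sum_blk, Finset.sum_eq_single i,
    Finset.sum_eq_single i] at hso
  · rw [blk_mul_transpose, rowBlk_blkMulRight, Pi.single_eq_same, hSΩ, hxx, hAi,
      finner_smul_right, finner_smul_right, finner_vecMulVec, finner_vecMulVec] at hso
    have h1 := le_of_mul_le_mul_left hso hvv
    refine le_trans ?_ h1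
    rw [Matrix.one_mulVec]
    exact Finset.sum_nonneg fun _ _ => mul_self_nonneg _
  · intro j _ hj
    rw [blk_mul_transpose, rowBlk_blkMulRight _ _ j, Pi.single_eq_of_ne hj]
    simp [finner]
  · simp
  · intro j _ hj
    refine Finset.sum_eq_zero fun k _ => ?_
    rw [blk_mul_transpose, rowBlk_blkMulRight _ _ j, Pi.single_eq_of_ne hj]
    simp [finner]
  · simp
  · intro j _ hj
    rw [Pi.single_eq_of_ne hj]
    simp [finner]
  · simp

end Critical

section Averaging

variable {a b : Type*} [Fintype a] [Fintype b] [DecidableEq a] [DecidableEq b]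

theorem sum_single_mul_single (M : Matrix b a ℝ) :
    ∑ e : a × b, Matrix.single e.1 e.2 (1 : ℝ) * M * Matrix.single e.1 e.2 (1 : ℝ) = Mᵀ := by
  conv_rhs => rw [matrix_eq_sum_single Mᵀ]
  simp only [Matrix.single_mul_mul_single, Fintype.sum_prod_type, one_mul, mul_one,
    Matrix.transpose_apply]

theorem sum_single_transpose_mul_single (M : Matrix a a ℝ) :
    ∑ e : a × b, (Matrix.single e.1 e.2 (1 : ℝ))ᵀ * M * Matrix.single e.1 e.2 (1 : ℝ) =
      M.trace • (1 : Matrix b b ℝ) := by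
  simp only [Matrix.transpose_single, Matrix.single_mul_mul_single, one_mul, mul_one]
  rw [Fintype.sum_prod_type, Finset.sum_comm]
  ext x y
  simp [Matrix.sum_apply, Matrix.single_apply, Matrix.one_apply, Matrix.trace, ite_and]

/-- Averaging the tangent directions `Γ - U Γᵀ U` over an orthonormal basis of `Γ`. -/
theorem sum_single_tangent {U V : Matrix a b ℝ} (hU : U * Uᵀ = 1) (hV : V * Vᵀ = 1) :
    ∑ e : a × b,
      (Matrix.single e.1 e.2 (1 : ℝ) - U * (Matrix.single e.1 e.2 (1 : ℝ))ᵀ * U) *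
        (Matrix.single e.1 e.2 (1 : ℝ) - V * (Matrix.single e.1 e.2 (1 : ℝ))ᵀ * V)ᵀ =
      ((Fintype.card b : ℝ) - 2) • (1 : Matrix a a ℝ) + (U * Vᵀ).trace • (U * Vᵀ) := by
  have h1 : ∑ e : a × b, Matrix.single e.1 e.2 (1 : ℝ) * (Matrix.single e.1 e.2 (1 : ℝ))ᵀ =
      (Fintype.card b : ℝ) • (1 : Matrix a a ℝ) := by
    rw [Fintype.sum_prod_type]
    ext x y
    simp [Matrix.sum_apply, Matrix.single_apply, Matrix.one_apply, ite_and]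
  have h2 := congrArg (· * Vᵀ) (sum_single_mul_single (a := a) (b := b) Vᵀ)
  have h3 := congrArg (fun X => (X * Uᵀ)ᵀ) (sum_single_mul_single (a := a) (b := b) Uᵀ)
  have h4 := congrArg (U * · * Vᵀ) (sum_single_transpose_mul_single (a := a) (b := b) (U * Vᵀ))
  simp only [Matrix.transpose_transpose, Matrix.sum_mul,
    Matrix.mul_sum, Matrix.transpose_sum, hU, hV, Matrix.transpose_one, Matrix.transpose_mul,
    Matrix.mul_smul, Matrix.smul_mul, Matrix.mul_one] at h2 h3 h4
  have h5 : ∀ e : a × b,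
      (Matrix.single e.1 e.2 (1 : ℝ) - U * (Matrix.single e.1 e.2 (1 : ℝ))ᵀ * U) *
        (Matrix.single e.1 e.2 (1 : ℝ) - V * (Matrix.single e.1 e.2 (1 : ℝ))ᵀ * V)ᵀ =
      Matrix.single e.1 e.2 (1 : ℝ) * (Matrix.single e.1 e.2 (1 : ℝ))ᵀ
        - Matrix.single e.1 e.2 (1 : ℝ) * Vᵀ * Matrix.single e.1 e.2 (1 : ℝ) * Vᵀ
        - U * ((Matrix.single e.1 e.2 (1 : ℝ))ᵀ * (U * (Matrix.single e.1 e.2 (1 : ℝ))ᵀ))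
        + U * ((Matrix.single e.1 e.2 (1 : ℝ))ᵀ * (U * Vᵀ) * Matrix.single e.1 e.2 (1 : ℝ)) * Vᵀ :=
    fun e => by
    simp only [Matrix.transpose_sub, Matrix.transpose_mul, Matrix.transpose_transpose,
      Matrix.sub_mul, Matrix.mul_sub, Matrix.mul_assoc]
    abel
  simp only [h5, Finset.sum_add_distrib, Finset.sum_sub_distrib, h1, h2, h3, h4]
  module

variable {n d p : ℕ}

theorem isLocalMax.averaged_second_order {A : Matrix (Fin n × Fin d) (Fin n × Fin d) ℝ}
    {S : Matrix (Fin n × Fin d) (Fin p) ℝ} (hA : A.IsSymm) (hS : isLocalMax A S)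
    {G : Matrix (Fin n × Fin d) (Fin d) ℝ} (hG : StiefelBlocks G) :
    ∑ i, ∑ j, finner (blk A i j) (((p : ℝ) - 2) • (rowBlk G i * (rowBlk G j)ᵀ) +
      ((rowBlk G i)ᵀ * rowBlk S i * ((rowBlk G j)ᵀ * rowBlk S j)ᵀ).trace •
        (rowBlk S i * (rowBlk S j)ᵀ)) ≤ ((p : ℝ) + d - 2) * finner (A * S) S := by
  have hG' : ∀ i, (rowBlk G i)ᵀ * rowBlk G i = 1 := fun i => mul_eq_one_comm.1 (hG i)
  set U : Fin n → Matrix (Fin d) (Fin p) ℝ := fun i => (rowBlk G i)ᵀ * rowBlk S i with hUdef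
  have hGU : ∀ i, rowBlk G i * U i = rowBlk S i := fun i => by
    rw [hUdef, ← Matrix.mul_assoc, hG i, Matrix.one_mul]
  have hU : ∀ i, U i * (U i)ᵀ = 1 := fun i => by
    simp only [hUdef]
    rw [Matrix.transpose_mul, Matrix.transpose_transpose, Matrix.mul_assoc,
      ← Matrix.mul_assoc (rowBlk S i), hS.1 i, Matrix.one_mul, hG' i]
  set Ω : Fin d × Fin p → Fin n → Matrix (Fin p) (Fin p) ℝ := fun e i =>
    (U i)ᵀ * Matrix.single e.1 e.2 (1 : ℝ) - (Matrix.single e.1 e.2 (1 : ℝ))ᵀ * U i with hΩdef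
  have hΩ : ∀ e i, (Ω e i)ᵀ = - Ω e i := fun e i => by
    simp only [hΩdef, Matrix.transpose_sub, Matrix.transpose_mul, Matrix.transpose_transpose,
      neg_sub]
  have hSΩ : ∀ e i, rowBlk S i * Ω e i =
      rowBlk G i * (Matrix.single e.1 e.2 (1 : ℝ) - U i * (Matrix.single e.1 e.2 (1 : ℝ))ᵀ * U i) :=
    fun e i => by
    conv_lhs => rw [← hGU i]
    simp only [hΩdef, Matrix.mul_sub, Matrix.mul_assoc]
    rw [← Matrix.mul_assoc (U i), hU i, Matrix.one_mul]
  have hsum : ∀ i j, ∑ e, rowBlk S i * Ω e i * (rowBlk S j * Ω e j)ᵀ =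
      ((p : ℝ) - 2) • (rowBlk G i * (rowBlk G j)ᵀ) +
        (U i * (U j)ᵀ).trace • (rowBlk S i * (rowBlk S j)ᵀ) := fun i j => by
    have h := congrArg (rowBlk G i * · * (rowBlk G j)ᵀ) (sum_single_tangent (hU i) (hU j))
    simp only [Matrix.sum_mul, Matrix.mul_sum, Matrix.mul_add, Matrix.add_mul, Matrix.mul_smul,
      Matrix.smul_mul, Matrix.mul_one, Fintype.card_fin] at h
    have e : rowBlk S i * (rowBlk S j)ᵀ = rowBlk G i * (U i * (U j)ᵀ) * (rowBlk G j)ᵀ := by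
      rw [← hGU i, ← hGU j, Matrix.transpose_mul]
      simp only [Matrix.mul_assoc]
    rw [e, ← h]
    refine Finset.sum_congr rfl fun e _ => ?_
    rw [hSΩ, hSΩ, Matrix.transpose_mul]
    simp only [Matrix.mul_assoc]
  have hso := Finset.sum_le_sum fun e (_ : e ∈ Finset.univ) =>
    hS.second_order hA (hΩ e)
  have hl : ∑ e, finner A (blkMulRight S (Ω e) * (blkMulRight S (Ω e))ᵀ) =
      ∑ i, ∑ j, finner (blk A i j) (((p : ℝ) - 2) • (rowBlk G i * (rowBlk G j)ᵀ) +
        (U i * (U j)ᵀ).trace • (rowBlk S i * (rowBlk S j)ᵀ)) := by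
    simp only [finner_eq_sum_blk A, ← hsum, finner_sum_right, blk_mul_transpose,
      rowBlk_blkMulRight]
    rw [Finset.sum_comm]
    exact Finset.sum_congr rfl fun i _ => Finset.sum_comm
  have hr : ∑ e, ∑ i, finner (rowBlk (A * S) i * (rowBlk S i)ᵀ)
        (rowBlk S i * Ω e i * (rowBlk S i * Ω e i)ᵀ) =
      ((p : ℝ) + d - 2) * finner (A * S) S := by
    rw [Finset.sum_comm, finner_eq_sum_rowBlk, Finset.mul_sum]
    refine Finset.sum_congr rfl fun i _ => ?_
    rw [← finner_sum_right, hsum, hU i, hG i, hS.1 i, finner_add_right,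
      finner_smul_right, finner_smul_right, finner_mul_right, Matrix.transpose_transpose,
      Matrix.one_mul, Matrix.trace_one, Fintype.card_fin]
    ring
  rw [hl, hr] at hso
  exact hso

end Averaging

section Deviation

variable {n d p : ℕ}

/-- The blocks `Gᵢᵀ Sᵢ` of `S` expressed in the frame `G`. -/
def gaugeBlk (G : Matrix (Fin n × Fin d) (Fin d) ℝ) (S : Matrix (Fin n × Fin d) (Fin p) ℝ)
    (i : Fin n) : Matrix (Fin d) (Fin p) ℝ :=
  (rowBlk G i)ᵀ * rowBlk S i

/-- The average of the blocks `Gᵢᵀ Sᵢ`. -/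
def gaugeMean (G : Matrix (Fin n × Fin d) (Fin d) ℝ) (S : Matrix (Fin n × Fin d) (Fin p) ℝ) :
    Matrix (Fin d) (Fin p) ℝ :=
  (n : ℝ)⁻¹ • ∑ i, gaugeBlk G S i

/-- The deviation of the block `Gᵢᵀ Sᵢ` from the average. -/
def gaugeDev (G : Matrix (Fin n × Fin d) (Fin d) ℝ) (S : Matrix (Fin n × Fin d) (Fin p) ℝ)
    (i : Fin n) : Matrix (Fin d) (Fin p) ℝ :=
  gaugeBlk G S i - gaugeMean G S

/-- The total squared deviation of the blocks `Gᵢᵀ Sᵢ` from their average. -/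
def devSq (G : Matrix (Fin n × Fin d) (Fin d) ℝ) (S : Matrix (Fin n × Fin d) (Fin p) ℝ) : ℝ :=
  ∑ i, finner (gaugeDev G S i) (gaugeDev G S i)

variable {G : Matrix (Fin n × Fin d) (Fin d) ℝ} {S : Matrix (Fin n × Fin d) (Fin p) ℝ}

theorem StiefelBlocks.transpose_mul_self (hG : StiefelBlocks G) (i : Fin n) :
    (rowBlk G i)ᵀ * rowBlk G i = 1 :=
  mul_eq_one_comm.1 (hG i)

theorem mul_gaugeBlk (hG : StiefelBlocks G) (i : Fin n) :
    rowBlk G i * gaugeBlk G S i = rowBlk S i := by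
  rw [gaugeBlk, ← Matrix.mul_assoc, hG i, Matrix.one_mul]

theorem finner_mul_mul_of_stiefel (hG : StiefelBlocks G) (i : Fin n)
    (V W : Matrix (Fin d) (Fin p) ℝ) :
    finner (rowBlk G i * V) (rowBlk G i * W) = finner V W := by
  rw [finner_mul_left, ← Matrix.mul_assoc, hG.transpose_mul_self, Matrix.one_mul]

theorem StiefelBlocks.finner_rowBlk (hS : StiefelBlocks S) (i : Fin n) :
    finner (rowBlk S i) (rowBlk S i) = d := by
  rw [finner_eq_trace, hS i, Matrix.trace_one, Fintype.card_fin]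

theorem StiefelBlocks.finner_self (hS : StiefelBlocks S) : finner S S = n * d := by
  rw [finner_eq_sum_rowBlk]
  simp [hS.finner_rowBlk]

theorem finner_gaugeBlk (hG : StiefelBlocks G) (hS : StiefelBlocks S) (i : Fin n) :
    finner (gaugeBlk G S i) (gaugeBlk G S i) = d := by
  rw [← finner_mul_mul_of_stiefel hG i, mul_gaugeBlk hG, hS.finner_rowBlk]

theorem gaugeBlk_mul_transpose (hG : StiefelBlocks G) (hS : StiefelBlocks S) (i : Fin n) :
    gaugeBlk G S i * (gaugeBlk G S i)ᵀ = 1 := by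
  rw [gaugeBlk, Matrix.transpose_mul, Matrix.transpose_transpose, Matrix.mul_assoc,
    ← Matrix.mul_assoc (rowBlk S i), hS i, Matrix.one_mul, hG.transpose_mul_self]

theorem devSq_nonneg : 0 ≤ devSq G S :=
  Finset.sum_nonneg fun _ _ => finner_self_nonneg _

theorem sum_gaugeBlk (hn : 0 < n) : ∑ i, gaugeBlk G S i = (n : ℝ) • gaugeMean G S := by
  rw [gaugeMean, smul_smul, mul_inv_cancel₀ (by positivity), one_smul]

theorem finner_gaugeMean (hn : 0 < n) (hG : StiefelBlocks G) (hS : StiefelBlocks S) :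
    n * finner (gaugeMean G S) (gaugeMean G S) = n * d - devSq G S := by
  have h : ∀ i, finner (gaugeDev G S i) (gaugeDev G S i) =
      d - 2 * finner (gaugeBlk G S i) (gaugeMean G S) +
        finner (gaugeMean G S) (gaugeMean G S) := fun i => by
    rw [gaugeDev, finner_sub_left, finner_sub_right, finner_sub_right, finner_gaugeBlk hG hS,
      finner_comm (gaugeMean G S) (gaugeBlk G S i)]
    ring
  rw [devSq]
  simp only [h, Finset.sum_add_distrib, Finset.sum_sub_distrib, ← Finset.mul_sum,
    Finset.sum_const, Finset.card_univ, Fintype.card_fin, nsmul_eq_mul]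
  rw [← finner_sum_left, sum_gaugeBlk hn, finner_smul_left]
  ring

theorem devSq_le (hn : 0 < n) (hG : StiefelBlocks G) (hS : StiefelBlocks S) :
    devSq G S ≤ n * d := by
  have h := finner_gaugeMean hn hG hS
  have : 0 ≤ (n : ℝ) * finner (gaugeMean G S) (gaugeMean G S) :=
    mul_nonneg n.cast_nonneg (finner_self_nonneg _)
  linarith

theorem finner_gaugeDev_le (hn : 0 < n) (hG : StiefelBlocks G) (hS : StiefelBlocks S)
    (i : Fin n) : finner (gaugeDev G S i) (gaugeDev G S i) ≤ 4 * d := by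
  have h1 : finner (gaugeMean G S) (gaugeMean G S) ≤ d := by
    have h := finner_gaugeMean hn hG hS
    have h0 : 0 ≤ devSq G S := devSq_nonneg
    have hn' : (0 : ℝ) < n := by positivity
    exact le_of_mul_le_mul_left (by linarith) hn'
  have h2 := finner_self_nonneg (gaugeBlk G S i + gaugeMean G S)
  rw [finner_add_left, finner_add_right, finner_add_right, finner_gaugeBlk hG hS,
      finner_comm (gaugeMean G S) (gaugeBlk G S i)] at h2
  rw [gaugeDev, finner_sub_left, finner_sub_right, finner_sub_right, finner_gaugeBlk hG hS,
      finner_comm (gaugeMean G S) (gaugeBlk G S i)]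
  linarith

theorem sum_sum_finner_gaugeBlk (hn : 0 < n) (hG : StiefelBlocks G) (hS : StiefelBlocks S) :
    ∑ i, ∑ j, finner (gaugeBlk G S i) (gaugeBlk G S j) = n ^ 2 * d - n * devSq G S := by
  simp only [← finner_sum_right, ← finner_sum_left]
  rw [sum_gaugeBlk hn, finner_smul_left, finner_smul_right, finner_gaugeMean hn hG hS]
  ring

theorem card_sub_finner_gaugeBlk (hG : StiefelBlocks G) (hS : StiefelBlocks S) (i j : Fin n) :
    d - finner (gaugeBlk G S i) (gaugeBlk G S j) =
      2⁻¹ * finner (gaugeDev G S i) (gaugeDev G S i) +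
        2⁻¹ * finner (gaugeDev G S j) (gaugeDev G S j) -
          finner (gaugeDev G S i) (gaugeDev G S j) := by
  simp only [gaugeDev, finner_sub_left, finner_sub_right, finner_gaugeBlk hG hS]
  rw [finner_comm (gaugeMean G S) (gaugeBlk G S i), finner_comm (gaugeMean G S) (gaugeBlk G S j)]
  ring

/-- Some constant gauge is nearly optimal for `S`. -/
theorem exists_sum_finner_sub_le (hn : 0 < n) (hG : StiefelBlocks G) (hS : StiefelBlocks S) :
    ∃ k, finner (S - G * gaugeBlk G S k) (S - G * gaugeBlk G S k) ≤ 2 * devSq G S := by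
  have : Nonempty (Fin n) := ⟨⟨0, hn⟩⟩
  have h : ∑ k, finner (S - G * gaugeBlk G S k) (S - G * gaugeBlk G S k) ≤
      ∑ _k : Fin n, 2 * devSq G S := by
    have e : ∀ k i, finner (rowBlk (S - G * gaugeBlk G S k) i)
        (rowBlk (S - G * gaugeBlk G S k) i) =
        2 * d - 2 * finner (gaugeBlk G S k) (gaugeBlk G S i) := fun k i => by
      have e1 : rowBlk (S - G * gaugeBlk G S k) i =
          rowBlk G i * (gaugeBlk G S i - gaugeBlk G S k) := by
        rw [Matrix.mul_sub, mul_gaugeBlk hG]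
        rfl
      rw [e1, finner_mul_mul_of_stiefel hG, finner_sub_left, finner_sub_right, finner_sub_right,
        finner_gaugeBlk hG hS, finner_gaugeBlk hG hS, finner_comm (gaugeBlk G S i)]
      ring
    simp only [finner_eq_sum_rowBlk, e, Finset.sum_sub_distrib, ← Finset.mul_sum,
      sum_sum_finner_gaugeBlk hn hG hS]
    simp only [Finset.sum_const, Finset.card_univ, Fintype.card_fin, nsmul_eq_mul]
    exact le_of_eq (by ring)
  obtain ⟨k, -, hk⟩ := Finset.exists_le_of_sum_le Finset.univ_nonempty h
  exact ⟨k, hk⟩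

/-- Multiply the `i`-th block row by the scalar `e i`. -/
def blkScale (e : Fin n → ℝ) (S : Matrix (Fin n × Fin d) (Fin p) ℝ) :
    Matrix (Fin n × Fin d) (Fin p) ℝ :=
  fun q l => e q.1 * S q l

theorem rowBlk_blkScale (e : Fin n → ℝ) (S : Matrix (Fin n × Fin d) (Fin p) ℝ) (i : Fin n) :
    rowBlk (blkScale e S) i = e i • rowBlk S i := rfl

theorem finner_blkScale (hS : StiefelBlocks S) (e : Fin n → ℝ) :
    finner (blkScale e S) (blkScale e S) = d * ∑ i, e i ^ 2 := by
  simp only [finner_eq_sum_rowBlk, rowBlk_blkScale, finner_smul_left, finner_smul_right,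
    hS.finner_rowBlk, Finset.mul_sum]
  exact Finset.sum_congr rfl fun i _ => by ring

theorem finner_sub_le_of_devSq (hn : 0 < n) (hG : StiefelBlocks G) (hS : StiefelBlocks S)
    {Δ : Matrix (Fin n × Fin d) (Fin n × Fin d) ℝ} (hΔ : Δ.IsSymm) :
    finner Δ (S * Sᵀ) - finner Δ (G * Gᵀ) ≤ 3 * opNorm Δ * √(n * d) * √(devSq G S) := by
  obtain ⟨k, hk⟩ := exists_sum_finner_sub_le hn hG hS
  set V := G * gaugeBlk G S k with hV
  have hVV : V * Vᵀ = G * Gᵀ := by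
    rw [hV, Matrix.transpose_mul, Matrix.mul_assoc, ← Matrix.mul_assoc (gaugeBlk G S k),
      gaugeBlk_mul_transpose hG hS k,
      Matrix.one_mul]
  have hVS : finner Δ (V * Sᵀ) = finner Δ (S * Vᵀ) := by
    rw [← finner_transpose, hΔ.eq, Matrix.transpose_mul, Matrix.transpose_transpose]
  have e : finner Δ (S * Sᵀ) - finner Δ (G * Gᵀ) = finner Δ ((S + V) * (S - V)ᵀ) := by
    rw [← hVV, Matrix.transpose_sub, Matrix.mul_sub, Matrix.add_mul, Matrix.add_mul,
      finner_sub_right, finner_add_right, finner_add_right, hVS]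
    ring
  have hVn : frobNorm V = √(n * d) := by
    rw [frobNorm_eq, finner_eq_trace, hVV, ← finner_eq_trace, hG.finner_self]
  have hSn : frobNorm S = √(n * d) := by rw [frobNorm_eq, hS.finner_self]
  have h1 := frobNorm_add_le S V
  rw [hVn, hSn] at h1
  have h2 : frobNorm (S - V) ≤ 3 / 2 * √(devSq G S) := by
    refine abs_le_of_sq_le_sq' ?_ (by positivity) |>.2
    rw [frobNorm_sq, mul_pow, Real.sq_sqrt devSq_nonneg]
    have : 0 ≤ devSq G S := devSq_nonneg
    linarith
  have h3 := (abs_le.1 (abs_finner_mul_transpose_le Δ (S + V) (S - V))).2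
  rw [e]
  refine h3.trans ?_
  have h4 := opNorm_nonneg Δ
  calc opNorm Δ * frobNorm (S + V) * frobNorm (S - V)
      ≤ opNorm Δ * (√(n * d) + √(n * d)) * (3 / 2 * √(devSq G S)) := by
        gcongr
        exact frobNorm_nonneg _
    _ = _ := by ring

theorem sum_card_sub_mul_finner_le (hn : 0 < n) (hG : StiefelBlocks G) (hS : StiefelBlocks S)
    (Δ : Matrix (Fin n × Fin d) (Fin n × Fin d) ℝ) :
    ∑ i, ∑ j, (d - finner (gaugeBlk G S i) (gaugeBlk G S j)) *
      finner (blk Δ i j) (rowBlk S i * (rowBlk S j)ᵀ) ≤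
        3 * d * opNorm Δ * √(n * d) * √(devSq G S) := by
  set e : Fin n → ℝ := fun i => finner (gaugeDev G S i) (gaugeDev G S i) with he
  set F := gaugeDev G S with hF
  have hc := opNorm_nonneg Δ
  have hSn : frobNorm S = √(n * d) := by rw [frobNorm_eq, hS.finner_self]
  have hV : frobNorm (blkScale e S) ≤ 2 * d * √(devSq G S) := by
    refine abs_le_of_sq_le_sq' ?_ (by positivity) |>.2
    rw [frobNorm_sq, finner_blkScale hS, mul_pow, Real.sq_sqrt devSq_nonneg]
    have : ∑ i, e i ^ 2 ≤ 4 * d * devSq G S := by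
      rw [devSq, Finset.mul_sum]
      refine Finset.sum_le_sum fun i _ => ?_
      rw [pow_two]
      exact mul_le_mul_of_nonneg_right (finner_gaugeDev_le hn hG hS i) (finner_self_nonneg _)
    have := mul_le_mul_of_nonneg_left this (Nat.cast_nonneg (α := ℝ) d)
    linarith
  have h1 : finner Δ (blkScale e S * Sᵀ) ≤ 2 * d * opNorm Δ * √(n * d) * √(devSq G S) := by
    refine (abs_le.1 (abs_finner_mul_transpose_le Δ (blkScale e S) S)).2.trans ?_
    rw [hSn]
    calc _ ≤ opNorm Δ * (2 * d * √(devSq G S)) * √(n * d) := by gcongr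
      _ = _ := by ring
  have h2 : finner Δ (S * (blkScale e S)ᵀ) ≤ 2 * d * opNorm Δ * √(n * d) * √(devSq G S) := by
    refine (abs_le.1 (abs_finner_mul_transpose_le Δ S (blkScale e S))).2.trans ?_
    rw [hSn]
    calc _ ≤ opNorm Δ * √(n * d) * (2 * d * √(devSq G S)) := by gcongr
      _ = _ := by ring
  have h3 : -(d * opNorm Δ * √(n * d) * √(devSq G S)) ≤ ∑ q : Fin d × Fin p,
      finner Δ (blkScale (fun i => F i q.1 q.2) S * (blkScale (fun i => F i q.1 q.2) S)ᵀ) := by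
    have h4 : ∀ q : Fin d × Fin p, -(opNorm Δ * (d * ∑ i, F i q.1 q.2 ^ 2)) ≤
        finner Δ (blkScale (fun i => F i q.1 q.2) S *
          (blkScale (fun i => F i q.1 q.2) S)ᵀ) := fun q => by
      have := (abs_le.1 (abs_finner_mul_transpose_le Δ (blkScale (fun i => F i q.1 q.2) S)
        (blkScale (fun i => F i q.1 q.2) S))).1
      rw [mul_assoc, ← pow_two, frobNorm_sq, finner_blkScale hS] at this
      exact this
    refine le_trans ?_ (Finset.sum_le_sum fun q _ => h4 q)
    rw [Finset.sum_neg_distrib, neg_le_neg_iff, ← Finset.mul_sum, ← Finset.mul_sum,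
      Finset.sum_comm]
    have h5 : ∑ i, ∑ q : Fin d × Fin p, F i q.1 q.2 ^ 2 = √(devSq G S) * √(devSq G S) := by
      rw [Real.mul_self_sqrt devSq_nonneg, devSq]
      simp only [finner, Fintype.sum_prod_type, pow_two, hF]
    have h6 : √(devSq G S) ≤ √(n * d) := Real.sqrt_le_sqrt (devSq_le hn hG hS)
    rw [h5]
    calc opNorm Δ * (d * (√(devSq G S) * √(devSq G S)))
        ≤ opNorm Δ * (d * (√(n * d) * √(devSq G S))) := by gcongr
      _ = _ := by ring
  have key : ∑ i, ∑ j, (d - finner (gaugeBlk G S i) (gaugeBlk G S j)) *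
      finner (blk Δ i j) (rowBlk S i * (rowBlk S j)ᵀ) =
      2⁻¹ * finner Δ (blkScale e S * Sᵀ) + 2⁻¹ * finner Δ (S * (blkScale e S)ᵀ) -
      ∑ q : Fin d × Fin p,
      finner Δ (blkScale (fun i => F i q.1 q.2) S * (blkScale (fun i => F i q.1 q.2) S)ᵀ) := by
    have e1 : ∀ a b : Fin n → ℝ, finner Δ (blkScale a S * (blkScale b S)ᵀ) =
        ∑ i, ∑ j, a i * b j * finner (blk Δ i j) (rowBlk S i * (rowBlk S j)ᵀ) := fun a b => by
      rw [finner_eq_sum_blk]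
      refine Finset.sum_congr rfl fun i _ => Finset.sum_congr rfl fun j _ => ?_
      rw [blk_mul_transpose, rowBlk_blkScale, rowBlk_blkScale, Matrix.smul_mul,
        Matrix.transpose_smul, Matrix.mul_smul, finner_smul_right, finner_smul_right, mul_assoc]
    have e2 : blkScale (fun _ => 1) S = S := by
      ext q l
      simp [blkScale]
    have e3 := e1 e (fun _ => 1)
    have e4 := e1 (fun _ => 1) e
    rw [e2] at e3 e4
    have e5 : ∑ q : Fin d × Fin p,
        finner Δ (blkScale (fun i => F i q.1 q.2) S * (blkScale (fun i => F i q.1 q.2) S)ᵀ) =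
        ∑ i, ∑ j, finner (F i) (F j) * finner (blk Δ i j) (rowBlk S i * (rowBlk S j)ᵀ) := by
      rw [Finset.sum_congr rfl fun q _ => e1 _ _, Finset.sum_comm]
      refine Finset.sum_congr rfl fun i _ => ?_
      rw [Finset.sum_comm]
      refine Finset.sum_congr rfl fun j _ => ?_
      rw [← Finset.sum_mul]
      exact congrArg (· * _) (Fintype.sum_prod_type _)
    rw [e3, e4, e5]
    simp only [Finset.mul_sum, ← Finset.sum_add_distrib, ← Finset.sum_sub_distrib]
    refine Finset.sum_congr rfl fun i _ => Finset.sum_congr rfl fun j _ => ?_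
    rw [card_sub_finner_gaugeBlk hG hS, ← hF]
    simp only [he]
    ring
  rw [key]
  linarith

end Deviation

section Localization

variable {n d p : ℕ} {A Δ : Matrix (Fin n × Fin d) (Fin n × Fin d) ℝ}
  {G : Matrix (Fin n × Fin d) (Fin d) ℝ} {S : Matrix (Fin n × Fin d) (Fin p) ℝ}

theorem isSymm_mul_transpose_add (hΔ : Δ.IsSymm) : (G * Gᵀ + Δ).IsSymm := by
  rw [Matrix.IsSymm, Matrix.transpose_add, Matrix.transpose_mul, Matrix.transpose_transpose, hΔ.eq]

theorem transpose_mul_eq_sum_gaugeBlk : Gᵀ * S = ∑ i, gaugeBlk G S i := by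
  ext a b
  simp only [Matrix.mul_apply, Matrix.sum_apply, Fintype.sum_prod_type, gaugeBlk, rowBlk,
    Matrix.transpose_apply]

theorem finner_mul_transpose_eq (i j : Fin n) :
    finner (rowBlk G i * (rowBlk G j)ᵀ) (rowBlk S i * (rowBlk S j)ᵀ) =
      finner (gaugeBlk G S i) (gaugeBlk G S j) := by
  rw [finner_mul_left, ← Matrix.mul_assoc, finner_comm, finner_mul_right,
    Matrix.transpose_transpose]
  rfl

theorem isLocalMax.scalar_second_order (hG : StiefelBlocks G) (hΔ : Δ.IsSymm)
    (hS : isLocalMax (G * Gᵀ + Δ) S) :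
    ((p : ℝ) - 2) * (n ^ 2 * d + finner Δ (G * Gᵀ)) +
      (∑ i, ∑ j, finner (gaugeBlk G S i) (gaugeBlk G S j) ^ 2 +
        ∑ i, ∑ j, finner (gaugeBlk G S i) (gaugeBlk G S j) *
          finner (blk Δ i j) (rowBlk S i * (rowBlk S j)ᵀ)) ≤
      ((p : ℝ) + d - 2) * (∑ i, ∑ j, finner (gaugeBlk G S i) (gaugeBlk G S j) +
        finner Δ (S * Sᵀ)) := by
  have h := hS.averaged_second_order (isSymm_mul_transpose_add hΔ) hG
  have hr : finner ((G * Gᵀ + Δ) * S) S =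
      ∑ i, ∑ j, finner (gaugeBlk G S i) (gaugeBlk G S j) + finner Δ (S * Sᵀ) := by
    rw [finner_mul_right, finner_add_left, finner_eq_sum_blk (G * Gᵀ)]
    simp only [blk_mul_transpose, finner_mul_transpose_eq]
  have hd : ∀ i j, finner (rowBlk G i * (rowBlk G j)ᵀ) (rowBlk G i * (rowBlk G j)ᵀ) = d :=
    fun i j => by
      rw [finner_mul_left, ← Matrix.mul_assoc, hG.transpose_mul_self, Matrix.one_mul,
        finner_transpose, hG.finner_rowBlk]
  rw [hr] at h
  refine le_trans (le_of_eq ?_) h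
  simp only [blk_add, blk_mul_transpose, finner_add_left, finner_add_right, finner_smul_right, hd,
    finner_mul_transpose_eq, finner_eq_sum_blk Δ (G * Gᵀ), mul_add]
  simp only [← finner_eq_trace, gaugeBlk, Finset.sum_add_distrib, ← Finset.mul_sum, pow_two,
    Finset.sum_const, Finset.card_univ, Fintype.card_fin, nsmul_eq_mul]
  ring

theorem finner_sub_mul_proj {S : Matrix (Fin d) (Fin p) ℝ} (hS : S * Sᵀ = 1)
    (X : Matrix (Fin d) (Fin p) ℝ) :
    finner (X - X * Sᵀ * S) (X - X * Sᵀ * S) = finner X X - finner (X * Sᵀ) (X * Sᵀ) := by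
  have h : finner (X * Sᵀ * S) (X * Sᵀ * S) = finner (X * Sᵀ) (X * Sᵀ) := by
    rw [finner_mul_right, Matrix.mul_assoc _ S, hS, Matrix.mul_one]
  have h' : finner (X * Sᵀ * S) X = finner (X * Sᵀ) (X * Sᵀ) := by
    rw [finner_mul_right]
  rw [finner_sub_left, finner_sub_right, finner_sub_right, finner_comm X (X * Sᵀ * S), h, h']
  ring

theorem rowBlk_mul_add (i : Fin n) :
    rowBlk ((G * Gᵀ + Δ) * S) i = rowBlk G i * (Gᵀ * S) + rowBlk (Δ * S) i := by
  rw [Matrix.add_mul, Matrix.mul_assoc]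
  rfl

theorem isLocalMax.sum_finner_sub_le (hG : StiefelBlocks G) (hΔ : Δ.IsSymm)
    (hS : isLocalMax (G * Gᵀ + Δ) S) :
    n * finner (Gᵀ * S) (Gᵀ * S) -
      ∑ i, finner (Gᵀ * S * (rowBlk S i)ᵀ) (Gᵀ * S * (rowBlk S i)ᵀ) ≤
        opNorm Δ ^ 2 * (n * d) := by
  have h1 : ∀ i, finner (Gᵀ * S) (Gᵀ * S) -
      finner (Gᵀ * S * (rowBlk S i)ᵀ) (Gᵀ * S * (rowBlk S i)ᵀ) ≤
        finner (rowBlk (Δ * S) i) (rowBlk (Δ * S) i) := fun i => by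
    have h := (hS.first_order (isSymm_mul_transpose_add hΔ) i).2
    rw [rowBlk_mul_add, Matrix.add_mul, Matrix.add_mul] at h
    have e : rowBlk G i * (Gᵀ * S - Gᵀ * S * (rowBlk S i)ᵀ * rowBlk S i) =
        -(rowBlk (Δ * S) i - rowBlk (Δ * S) i * (rowBlk S i)ᵀ * rowBlk S i) := by
      rw [Matrix.mul_sub]
      simp only [Matrix.mul_assoc] at h ⊢
      rw [eq_neg_iff_add_eq_zero, ← sub_eq_zero.2 h.symm]
      abel
    have e2 := finner_mul_mul_of_stiefel hG i
      (Gᵀ * S - Gᵀ * S * (rowBlk S i)ᵀ * rowBlk S i) (Gᵀ * S - Gᵀ * S * (rowBlk S i)ᵀ * rowBlk S i)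
    rw [e, finner_neg_left, finner_comm, finner_neg_left, neg_neg, finner_sub_mul_proj (hS.1 i),
      finner_sub_mul_proj (hS.1 i)] at e2
    have := finner_self_nonneg (rowBlk (Δ * S) i * (rowBlk S i)ᵀ)
    linarith
  have h2 := Finset.sum_le_sum fun i (_ : i ∈ Finset.univ) => h1 i
  rw [← finner_eq_sum_rowBlk, Finset.sum_sub_distrib] at h2
  simp only [Finset.sum_const, Finset.card_univ, Fintype.card_fin, nsmul_eq_mul] at h2
  refine h2.trans ?_
  have h3 := pow_le_pow_left₀ (frobNorm_nonneg _) (frobNorm_mul_le Δ S) 2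
  rwa [mul_pow, frobNorm_sq, frobNorm_sq, hS.1.finner_self] at h3

theorem isLocalMax.sum_sq_ge_of_one {Δ : Matrix (Fin n × Fin 1) (Fin n × Fin 1) ℝ}
    {G : Matrix (Fin n × Fin 1) (Fin 1) ℝ} {S : Matrix (Fin n × Fin 1) (Fin p) ℝ} (hn : 0 < n)
    (hG : StiefelBlocks G) (hΔ : Δ.IsSymm) (hS : isLocalMax (G * Gᵀ + Δ) S) :
    ∑ i, ∑ j, finner (gaugeBlk G S i) (gaugeBlk G S j) - opNorm Δ ^ 2 ≤
      ∑ i, ∑ j, finner (gaugeBlk G S i) (gaugeBlk G S j) ^ 2 := by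
  have h := hS.sum_finner_sub_le hG hΔ
  have h1 : finner (Gᵀ * S) (Gᵀ * S) = ∑ i, ∑ j, finner (gaugeBlk G S i) (gaugeBlk G S j) := by
    simp only [← finner_sum_right, ← finner_sum_left, transpose_mul_eq_sum_gaugeBlk]
  have h2 : ∀ i, finner (Gᵀ * S * (rowBlk S i)ᵀ) (Gᵀ * S * (rowBlk S i)ᵀ) ≤
      n * ∑ j, finner (gaugeBlk G S i) (gaugeBlk G S j) ^ 2 := fun i => by
    have e : finner (Gᵀ * S * (rowBlk S i)ᵀ) (Gᵀ * S * (rowBlk S i)ᵀ) =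
        (∑ j, finner (gaugeBlk G S i) (gaugeBlk G S j)) ^ 2 := by
      have e1 : finner (Gᵀ * S * (rowBlk S i)ᵀ) (Gᵀ * S * (rowBlk S i)ᵀ) =
          finner (Gᵀ * S * (gaugeBlk G S i)ᵀ) (Gᵀ * S * (gaugeBlk G S i)ᵀ) := by
        rw [← mul_gaugeBlk hG i, Matrix.transpose_mul, ← Matrix.mul_assoc, finner_mul_right,
          Matrix.transpose_transpose, Matrix.mul_assoc _ _ (rowBlk G i), hG.transpose_mul_self,
          Matrix.mul_one]
      rw [e1, ← finner_sum_right, ← transpose_mul_eq_sum_gaugeBlk, finner_comm (gaugeBlk G S i),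
        finner_eq_trace (Gᵀ * S)]
      simp [finner, Matrix.trace, pow_two]
    rw [e]
    simpa using sq_sum_le_card_mul_sum_sq (s := (Finset.univ : Finset (Fin n)))
      (f := fun j => finner (gaugeBlk G S i) (gaugeBlk G S j))
  have h3 := Finset.sum_le_sum fun i (_ : i ∈ Finset.univ) => h2 i
  rw [← Finset.mul_sum] at h3
  rw [h1] at h
  have hn' : (0 : ℝ) < n := by positivity
  refine le_of_mul_le_mul_left ?_ hn'
  push_cast at h
  linarith

/-- A local maximizer is close to the ground truth up to a global gauge. -/
theorem isLocalMax.devSq_le_of_opNorm (hn : 0 < n) (hd : 1 ≤ d) (hp : 2 * d + 1 ≤ p)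
    (hG : StiefelBlocks G) (hΔ : Δ.IsSymm) (hS : isLocalMax (G * Gᵀ + Δ) S) :
    √(n * devSq G S) ≤
      4 * ((p : ℝ) + d) / ((p : ℝ) - 2 * d) * opNorm Δ * √d := by
  have hso := hS.scalar_second_order hG hΔ
  have hA := finner_sub_le_of_devSq hn hG hS.1 hΔ
  have hB := sum_card_sub_mul_finner_le hn hG hS.1 Δ
  have hs := sum_sum_finner_gaugeBlk hn hG hS.1
  have hB' : ∑ i, ∑ j, (d - finner (gaugeBlk G S i) (gaugeBlk G S j)) *
      finner (blk Δ i j) (rowBlk S i * (rowBlk S j)ᵀ) = d * finner Δ (S * Sᵀ) -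
      ∑ i, ∑ j, finner (gaugeBlk G S i) (gaugeBlk G S j) *
          finner (blk Δ i j) (rowBlk S i * (rowBlk S j)ᵀ) := by
    simp only [sub_mul, Finset.sum_sub_distrib, ← Finset.mul_sum, finner_eq_sum_blk Δ,
      blk_mul_transpose]
  rw [hB'] at hB
  set c := opNorm Δ with hc
  have hc0 : 0 ≤ c := opNorm_nonneg Δ
  set τ := ∑ i, ∑ j, finner (gaugeBlk G S i) (gaugeBlk G S j) ^ 2 with hτ
  set e := devSq G S with he
  have he0 : 0 ≤ e := devSq_nonneg
  have hpd : (2 * d + 1 : ℝ) ≤ p := by exact_mod_cast hp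
  have hd' : (1 : ℝ) ≤ d := by exact_mod_cast hd
  have hw : √(n * d) * √e = √d * √(n * e) := by
    rw [← Real.sqrt_mul (by positivity), ← Real.sqrt_mul (by positivity)]
    congr 1
    ring
  rw [mul_assoc, hw] at hA hB
  have hu2 : √(n * e) ^ 2 = n * e := Real.sq_sqrt (by positivity)
  have hu0 : 0 ≤ √(n * e) := Real.sqrt_nonneg _
  set u := √(n * e) with hu
  have hmain : ((p : ℝ) - 2) * (n ^ 2 * d) + τ - ((p : ℝ) + d - 2) * (n ^ 2 * d - u ^ 2) ≤
      3 * ((p : ℝ) + d - 2) * c * √d * u := by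
    have hA' := mul_le_mul_of_nonneg_left hA (by linarith : (0 : ℝ) ≤ (p : ℝ) - 2)
    rw [hs, ← hu2] at hso
    linarith
  have hgap : (0 : ℝ) < (p : ℝ) - 2 * d := by linarith
  rw [div_mul_eq_mul_div, div_mul_eq_mul_div, le_div_iff₀ hgap]
  have hsd : 0 ≤ √(d : ℝ) := Real.sqrt_nonneg _
  rcases Nat.lt_or_ge 1 d with h2 | h2
  · have h2' : (2 : ℝ) ≤ d := by exact_mod_cast h2
    have hτ' : 2 * d * (n ^ 2 * d - u ^ 2) - n ^ 2 * d ^ 2 ≤ τ := by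
      have : 0 ≤ ∑ i, ∑ j, (finner (gaugeBlk G S i) (gaugeBlk G S j) - d) ^ 2 :=
        Finset.sum_nonneg fun i _ => Finset.sum_nonneg fun j _ => sq_nonneg _
      simp only [sub_sq, Finset.sum_add_distrib, Finset.sum_sub_distrib, mul_assoc,
        ← Finset.mul_sum, ← Finset.sum_mul, hs, Finset.sum_const, Finset.card_univ,
        Fintype.card_fin, nsmul_eq_mul] at this
      rw [← hτ, ← hu2] at this
      linarith
    have h3 : u * (((p : ℝ) - 2 * d) * u) ≤ u * (4 * ((p : ℝ) + d) * c * √d) := by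
      have h4 : 0 ≤ c * √d * u := by positivity
      have h5 : 0 ≤ ((p : ℝ) + d + 6) * (c * √d * u) := by positivity
      have h6 : 0 ≤ (d - 2) * u ^ 2 := mul_nonneg (by linarith) (sq_nonneg u)
      linarith
    rcases hu0.eq_or_lt with h0 | h0
    · rw [← h0, zero_mul]
      positivity
    · linarith [le_of_mul_le_mul_left h3 h0]
  · obtain rfl : d = 1 := le_antisymm h2 hd
    have hτ' := hS.sum_sq_ge_of_one hn hG hΔ
    rw [hs, ← hτ, ← hc, ← hu2] at hτ'
    simp only [Nat.cast_one, Real.sqrt_one] at *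
    by_contra! hlt
    have h3 : ((p : ℝ) - 2) * u ^ 2 ≤ c ^ 2 + 3 * ((p : ℝ) - 1) * c * u := by linarith
    have h4 := mul_le_mul_of_nonneg_right hlt.le hu0
    have hu' : 0 < u := by
      by_contra! h
      have : u = 0 := le_antisymm h hu0
      rw [this, zero_mul] at hlt
      have : 0 ≤ 4 * ((p : ℝ) + 1) * c * 1 := by positivity
      linarith
    nlinarith

end Localization

section Multiplier

variable {n d p q : ℕ} {A Δ : Matrix (Fin n × Fin d) (Fin n × Fin d) ℝ}
  {G : Matrix (Fin n × Fin d) (Fin d) ℝ} {S : Matrix (Fin n × Fin d) (Fin p) ℝ}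

theorem frobNorm_transpose {m k : Type*} [Fintype m] [Fintype k] (X : Matrix m k ℝ) :
    frobNorm Xᵀ = frobNorm X := by
  rw [frobNorm_eq, frobNorm_eq, finner_transpose]

theorem frobNorm_mul_transpose_le {m k l : Type*} [Fintype m] [Fintype k] [Fintype l]
    [DecidableEq k] (Y : Matrix l k ℝ) (X : Matrix m k ℝ) :
    frobNorm (Y * Xᵀ) ≤ opNorm X * frobNorm Y := by
  rw [← frobNorm_transpose, Matrix.transpose_mul, Matrix.transpose_transpose,
    ← frobNorm_transpose Y]
  exact frobNorm_mul_le X Yᵀ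

theorem frobNorm_mul_le' {m k l : Type*} [Fintype m] [Fintype k] [Fintype l]
    [DecidableEq k] (Y : Matrix l m ℝ) (X : Matrix m k ℝ) :
    frobNorm (Y * X) ≤ opNorm X * frobNorm Y := by
  rcases (frobNorm_nonneg (Y * X)).eq_or_lt with h | h
  · rw [← h]
    exact mul_nonneg (opNorm_nonneg X) (frobNorm_nonneg Y)
  · refine le_of_mul_le_mul_left ?_ h
    rw [← pow_two, frobNorm_sq, finner_mul_right, finner_comm]
    refine (finner_le _ _).trans ?_
    have := mul_le_mul_of_nonneg_right (frobNorm_mul_transpose_le (Y * X) X) (frobNorm_nonneg Y)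
    linarith

theorem finner_mul_self_le {m k l : Type*} [Fintype m] [Fintype k] [Fintype l]
    (Y : Matrix l m ℝ) (X : Matrix m k ℝ) :
    finner (Y * X) (Y * X) ≤ finner Y Y * finner X X := by
  have h : ∀ i j, (Y * X) i j * (Y * X) i j ≤ (∑ a, Y i a * Y i a) * ∑ a, X a j * X a j :=
    fun i j => by
      have := Finset.sum_mul_sq_le_sq_mul_sq Finset.univ (fun a => Y i a) (fun a => X a j)
      simpa only [Matrix.mul_apply, pow_two] using this
  refine (Finset.sum_le_sum fun i _ => Finset.sum_le_sum fun j _ => h i j).trans (le_of_eq ?_)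
  rw [← finner_transpose X]
  exact (Finset.sum_mul_sum _ _ _ _).symm

theorem finner_mul_of_stiefel {m : Type*} [Fintype m] {U : Matrix (Fin d) (Fin p) ℝ}
    (hU : U * Uᵀ = 1) (Y : Matrix m (Fin d) ℝ) : finner (Y * U) (Y * U) = finner Y Y := by
  rw [finner_mul_right, Matrix.mul_assoc, hU, Matrix.mul_one]

theorem finner_mul_gaugeMean (hn : 0 < n) (hG : StiefelBlocks G) (hS : StiefelBlocks S)
    (Y : Matrix (Fin q) (Fin d) ℝ) :
    n * finner (Y * gaugeMean G S) (Y * gaugeMean G S) = n * finner Y Y -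
      ∑ i, finner (Y * gaugeDev G S i) (Y * gaugeDev G S i) := by
  have h : ∀ i, finner (Y * gaugeDev G S i) (Y * gaugeDev G S i) =
      finner Y Y - 2 * finner (Y * gaugeBlk G S i) (Y * gaugeMean G S) +
        finner (Y * gaugeMean G S) (Y * gaugeMean G S) := fun i => by
    rw [gaugeDev, Matrix.mul_sub, finner_sub_left, finner_sub_right, finner_sub_right,
      finner_mul_of_stiefel (gaugeBlk_mul_transpose hG hS i),
      finner_comm (Y * gaugeMean G S) (Y * gaugeBlk G S i)]
    ring
  simp only [h, Finset.sum_add_distrib, Finset.sum_sub_distrib, ← Finset.mul_sum,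
    Finset.sum_const, Finset.card_univ, Fintype.card_fin, nsmul_eq_mul]
  rw [← finner_sum_left, ← Matrix.mul_sum, sum_gaugeBlk hn, Matrix.mul_smul, finner_smul_left]
  ring

theorem frobNorm_mul_gaugeMean_le (hn : 0 < n) (hG : StiefelBlocks G) (hS : StiefelBlocks S)
    (Y : Matrix (Fin q) (Fin d) ℝ) : frobNorm (Y * gaugeMean G S) ≤ frobNorm Y := by
  rw [frobNorm_eq, frobNorm_eq]
  refine Real.sqrt_le_sqrt ?_
  have h := finner_mul_gaugeMean hn hG hS Y
  have h0 : 0 ≤ ∑ i, finner (Y * gaugeDev G S i) (Y * gaugeDev G S i) :=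
    Finset.sum_nonneg fun i _ => finner_self_nonneg _
  have hn' : (0 : ℝ) < n := by positivity
  exact le_of_mul_le_mul_left (by linarith) hn'

theorem le_frobNorm_mul_gaugeMean (hn : 0 < n) (hG : StiefelBlocks G) (hS : StiefelBlocks S)
    (Y : Matrix (Fin q) (Fin d) ℝ) :
    (n - devSq G S) * frobNorm Y ≤ n * frobNorm (Y * gaugeMean G S) := by
  rcases le_total (n : ℝ) (devSq G S) with h | h
  · exact (mul_nonpos_of_nonpos_of_nonneg (by linarith) (frobNorm_nonneg Y)).trans
      (mul_nonneg n.cast_nonneg (frobNorm_nonneg _))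
  · refine abs_le_of_sq_le_sq' ?_ (mul_nonneg n.cast_nonneg (frobNorm_nonneg _)) |>.2
    rw [mul_pow, mul_pow, frobNorm_sq, frobNorm_sq, pow_two (n : ℝ), mul_assoc (n : ℝ),
      finner_mul_gaugeMean hn hG hS]
    have h1 : ∑ i, finner (Y * gaugeDev G S i) (Y * gaugeDev G S i) ≤
        finner Y Y * devSq G S := by
      rw [devSq, Finset.mul_sum]
      exact Finset.sum_le_sum fun i _ => finner_mul_self_le _ _
    have h2 := mul_le_mul_of_nonneg_left h1 (Nat.cast_nonneg (α := ℝ) n)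
    have h3 : 0 ≤ (n - devSq G S) * devSq G S * finner Y Y :=
      mul_nonneg (mul_nonneg (by linarith) devSq_nonneg) (finner_self_nonneg Y)
    linarith

theorem finner_sub_mul_gaugeMean (hG : StiefelBlocks G) :
    finner (S - G * gaugeMean G S) (S - G * gaugeMean G S) = devSq G S := by
  rw [finner_eq_sum_rowBlk, devSq]
  refine Finset.sum_congr rfl fun i _ => ?_
  have e : rowBlk (S - G * gaugeMean G S) i = rowBlk G i * gaugeDev G S i := by
    rw [gaugeDev, Matrix.mul_sub, mul_gaugeBlk hG]
    rfl
  rw [e, finner_mul_mul_of_stiefel hG]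

theorem rowBlk_mul_eq_colBlk (hΔ : Δ.IsSymm) (i : Fin n) :
    rowBlk (Δ * S) i = (colBlk Δ i)ᵀ * S := by
  ext a b
  simp only [rowBlk, Matrix.mul_apply, Matrix.transpose_apply, colBlk, hΔ.apply]

theorem frobNorm_mul_rowBlk_le (hn : 0 < n) (hG : StiefelBlocks G) (hS : StiefelBlocks S)
    (hΔ : Δ.IsSymm) (Y : Matrix (Fin q) (Fin d) ℝ) (i : Fin n) :
    frobNorm (Y * rowBlk (Δ * S) i) ≤
      (√(devSq G S) * opNorm (colBlk Δ i) + opNorm ((colBlk Δ i)ᵀ * G)) * frobNorm Y := by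
  have e : Y * rowBlk (Δ * S) i = Y * (colBlk Δ i)ᵀ * (S - G * gaugeMean G S) +
      Y * ((colBlk Δ i)ᵀ * G) * gaugeMean G S := by
    rw [rowBlk_mul_eq_colBlk hΔ, Matrix.mul_sub]
    simp only [Matrix.mul_assoc]
    abel
  rw [e]
  refine (frobNorm_add_le _ _).trans ?_
  have h1 : frobNorm (Y * (colBlk Δ i)ᵀ * (S - G * gaugeMean G S)) ≤
      opNorm (colBlk Δ i) * frobNorm Y * √(devSq G S) := by
    rw [frobNorm_eq]
    refine (Real.sqrt_le_sqrt (finner_mul_self_le _ _)).trans ?_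
    rw [Real.sqrt_mul (finner_self_nonneg _), finner_sub_mul_gaugeMean hG, ← frobNorm_eq]
    exact mul_le_mul_of_nonneg_right (frobNorm_mul_transpose_le _ _) (Real.sqrt_nonneg _)
  have h2 := (frobNorm_mul_gaugeMean_le hn hG hS (Y * ((colBlk Δ i)ᵀ * G))).trans
    (frobNorm_mul_le' _ _)
  linarith

theorem isLocalMax.le_frobNorm_mul_multiplier (hn : 0 < n) (hG : StiefelBlocks G)
    (hΔ : Δ.IsSymm) (hS : isLocalMax (G * Gᵀ + Δ) S) (Y : Matrix (Fin q) (Fin d) ℝ) (i : Fin n) :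
    (n - devSq G S - √(devSq G S) * opNorm (colBlk Δ i) - opNorm ((colBlk Δ i)ᵀ * G)) *
      frobNorm Y ≤ frobNorm (Y * (rowBlk ((G * Gᵀ + Δ) * S) i * (rowBlk S i)ᵀ)) := by
  have h := (hS.first_order (isSymm_mul_transpose_add hΔ) i).2
  have e : frobNorm (Y * (rowBlk ((G * Gᵀ + Δ) * S) i * (rowBlk S i)ᵀ)) =
      frobNorm (Y * rowBlk ((G * Gᵀ + Δ) * S) i) := by
    rw [frobNorm_eq, ← finner_mul_of_stiefel (hS.1 i), Matrix.mul_assoc Y, h, ← frobNorm_eq]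
  have e2 : (n : ℝ) • (Y * rowBlk G i * gaugeMean G S) =
      Y * rowBlk ((G * Gᵀ + Δ) * S) i + -(Y * rowBlk (Δ * S) i) := by
    rw [rowBlk_mul_add, Matrix.mul_add, transpose_mul_eq_sum_gaugeBlk, sum_gaugeBlk hn,
      Matrix.mul_smul, Matrix.mul_smul, Matrix.mul_assoc]
    abel
  have h3 := frobNorm_add_le (Y * rowBlk ((G * Gᵀ + Δ) * S) i) (-(Y * rowBlk (Δ * S) i))
  rw [← e2, frobNorm_smul, abs_of_nonneg n.cast_nonneg, frobNorm_neg] at h3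
  have h4 := le_frobNorm_mul_gaugeMean hn hG hS.1 (Y * rowBlk G i)
  have e3 : frobNorm (Y * rowBlk G i) = frobNorm Y := by
    rw [frobNorm_eq, finner_mul_of_stiefel (hG i), ← frobNorm_eq]
  rw [e3] at h4
  have h5 := frobNorm_mul_rowBlk_le hn hG hS.1 hΔ Y i
  rw [e]
  linarith

theorem lt_dotProduct_mulVec_of_lt_frobNorm {M : Matrix (Fin d) (Fin d) ℝ} (hM : M.IsSymm)
    (hM0 : ∀ x, 0 ≤ x ⬝ᵥ M *ᵥ x) {c μ : ℝ} (hcμ : c < μ)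
    (hμ : ∀ Y : Matrix (Fin 1) (Fin d) ℝ, μ * frobNorm Y ≤ frobNorm (Y * M))
    {x : Fin d → ℝ} (hx : x ≠ 0) : c * (x ⬝ᵥ x) < x ⬝ᵥ M *ᵥ x := by
  have hH : (M - c • (1 : Matrix (Fin d) (Fin d) ℝ)).IsHermitian := by
    rw [Matrix.IsHermitian, Matrix.conjTranspose_eq_transpose_of_trivial, Matrix.transpose_sub,
      Matrix.transpose_smul, Matrix.transpose_one, hM.eq]
  have hpd : (M - c • (1 : Matrix (Fin d) (Fin d) ℝ)).PosDef := by
    rw [hH.posDef_iff_eigenvalues_pos]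
    intro i
    set v : Fin d → ℝ := ⇑(hH.eigenvectorBasis i) with hv
    have h1 := hH.mulVec_eigenvectorBasis i
    rw [← hv, Matrix.sub_mulVec, Matrix.smul_mulVec, Matrix.one_mulVec] at h1
    set l := hH.eigenvalues i
    have h2 : M *ᵥ v = (l + c) • v := by
      rw [add_smul, ← h1]
      abel
    have hvv : v ⬝ᵥ v = 1 := by
      have := hH.eigenvectorBasis.orthonormal.1 i
      have h3 := EuclideanSpace.norm_sq_eq (hH.eigenvectorBasis i)
      rw [this] at h3
      simpa [dotProduct, pow_two] using h3.symm
    have h4 := hM0 v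
    rw [h2, dotProduct_smul, hvv, smul_eq_mul, mul_one] at h4
    have h5 := hμ (Matrix.of fun _ j => v j)
    have e1 : frobNorm (Matrix.of fun (_ : Fin 1) j => v j) = 1 := by
      rw [frobNorm_eq, Real.sqrt_eq_one]
      simpa [finner, dotProduct] using hvv
    have e2 : (Matrix.of fun (_ : Fin 1) j => v j) * M =
        (l + c) • (Matrix.of fun (_ : Fin 1) j => v j) := by
      ext a b
      have := congrFun h2 b
      simp only [Matrix.mulVec, dotProduct] at this
      simp only [Matrix.mul_apply, Matrix.of_apply, Matrix.smul_apply]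
      rw [Pi.smul_apply] at this
      rw [← this]
      exact Finset.sum_congr rfl fun j _ => by rw [hM.apply, mul_comm]
    rw [e2, frobNorm_smul, e1, abs_of_nonneg h4] at h5
    linarith
  have h := hpd.dotProduct_mulVec_pos hx
  simp only [star_trivial, Matrix.sub_mulVec, Matrix.smul_mulVec, Matrix.one_mulVec,
    dotProduct_sub, dotProduct_smul, smul_eq_mul] at h
  linarith

theorem four_mul_opNorm_le {κ : ℝ} (hp : 2 * d + 1 ≤ p)
    (hκ : κ = (2 + Real.sqrt 5) * ((p : ℝ) + d) / ((p : ℝ) - 2 * d) *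
        max (opNorm Δ) (opNorm (partialTrace Δ))) :
    4 * ((p : ℝ) + d) / ((p : ℝ) - 2 * d) * opNorm Δ ≤ κ := by
  have hpd : (2 * d + 1 : ℝ) ≤ p := by exact_mod_cast hp
  have h5 : (2 : ℝ) ≤ √5 := by
    rw [show (2 : ℝ) = √(2 ^ 2) by rw [Real.sqrt_sq (by norm_num)]]
    exact Real.sqrt_le_sqrt (by norm_num)
  have hgap : (0 : ℝ) < (p : ℝ) - 2 * d := by linarith
  rw [hκ]
  have h0 := opNorm_nonneg Δ
  have h1 := le_max_left (opNorm Δ) (opNorm (partialTrace Δ))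
  gcongr
  linarith

/-- Under the signal-to-noise condition, the multipliers of a local maximizer dominate the
noise. -/
theorem isLocalMax.opNorm_mul_lt {κ : ℝ} (hn : 2 ≤ n) (hd : 1 ≤ d) (hp : 2 * d + 1 ≤ p)
    (hG : StiefelBlocks G) (hΔ : Δ.IsSymm) (hΔdiag : ∀ i, blk Δ i i = 0)
    (hκ : κ = (2 + Real.sqrt 5) * ((p : ℝ) + d) / ((p : ℝ) - 2 * d) *
        max (opNorm Δ) (opNorm (partialTrace Δ)))
    (hcond : (n : ℝ) >
        3 * d * κ ^ 2 / (2 * n)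
        + Real.sqrt ((d : ℝ) / n) * κ * (⨆ i, opNorm (colBlk Δ i))
        + (⨆ i, opNorm ((colBlk Δ i)ᵀ * G))
        + opNorm Δ)
    (hS : isLocalMax (G * Gᵀ + Δ) S) (i : Fin n) {x : Fin d → ℝ} (hx : x ≠ 0) :
    opNorm Δ * (x ⬝ᵥ x) <
      x ⬝ᵥ (rowBlk ((G * Gᵀ + Δ) * S) i * (rowBlk S i)ᵀ) *ᵥ x := by
  have hA := isSymm_mul_transpose_add (G := G) hΔ
  have hAi : blk (G * Gᵀ + Δ) i i = 1 := by
    rw [blk_add, hΔdiag, add_zero, blk_mul_transpose, hG i]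
  have hn0 : 0 < n := by omega
  have hn' : (0 : ℝ) < n := by positivity
  refine lt_dotProduct_mulVec_of_lt_frobNorm (hS.first_order hA i).1
    (hS.multiplier_nonneg hA (by omega) hAi) ?_
    (fun Y => hS.le_frobNorm_mul_multiplier hn0 hG hΔ Y i) hx
  have h1 : √(n * devSq G S) ≤ κ * √d :=
    (hS.devSq_le_of_opNorm hn0 hd hp hG hΔ).trans
      (mul_le_mul_of_nonneg_right (four_mul_opNorm_le hp hκ) (Real.sqrt_nonneg _))
  have hκ0 : 0 ≤ κ := by
    refine le_trans ?_ (four_mul_opNorm_le hp hκ)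
    have hpd : (2 * d + 1 : ℝ) ≤ p := by exact_mod_cast hp
    exact mul_nonneg (div_nonneg (by positivity) (by linarith)) (opNorm_nonneg Δ)
  have h2 : √(devSq G S) ≤ √(d / n) * κ := by
    rw [Real.sqrt_div d.cast_nonneg, div_mul_eq_mul_div, le_div_iff₀ (by positivity)]
    rw [Real.sqrt_mul hn'.le] at h1
    linarith
  have h3 : devSq G S ≤ d * κ ^ 2 / n := by
    have := pow_le_pow_left₀ (Real.sqrt_nonneg _) h2 2
    rw [Real.sq_sqrt devSq_nonneg, mul_pow, Real.sq_sqrt (by positivity)] at this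
    exact this.trans (le_of_eq (by ring))
  have h4 : opNorm (colBlk Δ i) ≤ ⨆ i, opNorm (colBlk Δ i) :=
    le_ciSup (f := fun i => opNorm (colBlk Δ i)) (Set.finite_range _).bddAbove i
  have h5 : opNorm ((colBlk Δ i)ᵀ * G) ≤ ⨆ i, opNorm ((colBlk Δ i)ᵀ * G) :=
    le_ciSup (f := fun i => opNorm ((colBlk Δ i)ᵀ * G)) (Set.finite_range _).bddAbove i
  have h6 : √(devSq G S) * opNorm (colBlk Δ i) ≤
      √(d / n) * κ * ⨆ i, opNorm (colBlk Δ i) :=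
    mul_le_mul h2 h4 (opNorm_nonneg _) (by positivity)
  have h7 : d * κ ^ 2 / n ≤ 3 * d * κ ^ 2 / (2 * n) := by
    rw [div_le_div_iff₀ hn' (by positivity)]
    have : 0 ≤ d * κ ^ 2 * n := by positivity
    linarith
  linarith

end Multiplier

section Certificate

variable {n d p : ℕ} {A Δ : Matrix (Fin n × Fin d) (Fin n × Fin d) ℝ}
  {G : Matrix (Fin n × Fin d) (Fin d) ℝ} {S : Matrix (Fin n × Fin d) (Fin p) ℝ}
  {L : Fin n → Matrix (Fin d) (Fin d) ℝ}

theorem dotProduct_mulVec_le_opNorm {m : Type*} [Fintype m] [DecidableEq m] (X : Matrix m m ℝ)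
    (x : m → ℝ) : x ⬝ᵥ X *ᵥ x ≤ opNorm X * (x ⬝ᵥ x) := by
  have h := (abs_le.1 (abs_finner_mul_transpose_le X (Matrix.of fun i (_ : Fin 1) => x i)
    (Matrix.of fun i (_ : Fin 1) => x i))).2
  have e : (Matrix.of fun i (_ : Fin 1) => x i) * (Matrix.of fun i (_ : Fin 1) => x i)ᵀ =
      vecMulVec x x := by
    ext i j
    simp [Matrix.mul_apply, vecMulVec_apply]
  rw [e, finner_vecMulVec, mul_assoc, ← pow_two, frobNorm_sq] at h
  simpa [finner, dotProduct] using h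

theorem blkDiag_mulVec (x : Fin n × Fin d → ℝ) (i : Fin n) (k : Fin d) :
    (blkDiag L *ᵥ x) (i, k) = (L i *ᵥ fun l => x (i, l)) k := by
  simp only [Matrix.mulVec, dotProduct, blkDiag, Fintype.sum_prod_type]
  rw [Finset.sum_eq_single i]
  · simp
  · intro j _ hj
    simp [hj.symm]
  · simp

theorem dotProduct_blkDiag_mulVec (x : Fin n × Fin d → ℝ) :
    x ⬝ᵥ blkDiag L *ᵥ x = ∑ i, (fun k => x (i, k)) ⬝ᵥ L i *ᵥ fun k => x (i, k) := by
  simp only [dotProduct, Fintype.sum_prod_type, blkDiag_mulVec]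

theorem rowBlk_blkDiag_mul (i : Fin n) : rowBlk (blkDiag L * S) i = L i * rowBlk S i := by
  ext k l
  exact blkDiag_mulVec (fun q => S q l) i k

theorem finner_blkDiag (Y : Matrix (Fin n × Fin d) (Fin n × Fin d) ℝ)
    (hY : ∀ i, blk Y i i = 1) : finner (blkDiag L) Y = ∑ i, (L i).trace := by
  rw [finner_eq_sum_blk]
  refine Finset.sum_congr rfl fun i _ => ?_
  rw [Finset.sum_eq_single i]
  · rw [hY, finner_one_right]
    simp [blk, blkDiag, Matrix.trace]
  · intro j _ hj
    simp [finner, blk, blkDiag, hj.symm]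
  · simp

theorem isSymm_blkDiag (hL : ∀ i, (L i).IsSymm) : (blkDiag L).IsSymm := by
  ext ⟨i, k⟩ ⟨j, l⟩
  simp only [Matrix.transpose_apply, blkDiag]
  by_cases h : i = j
  · subst h
    simp [(hL i).apply]
  · simp [h, Ne.symm h]

theorem dotProduct_certificate_pos
    (hpos : ∀ i, ∀ x : Fin d → ℝ, x ≠ 0 → opNorm Δ * (x ⬝ᵥ x) < x ⬝ᵥ L i *ᵥ x)
    {x : Fin n × Fin d → ℝ} (hx : x ≠ 0) (hGx : Gᵀ *ᵥ x = 0) :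
    0 < x ⬝ᵥ (blkDiag L - (G * Gᵀ + Δ)) *ᵥ x := by
  have h1 : x ⬝ᵥ (G * Gᵀ) *ᵥ x = 0 := by
    rw [← Matrix.mulVec_mulVec, hGx, Matrix.mulVec_zero, dotProduct_zero]
  have h2 := dotProduct_mulVec_le_opNorm Δ x
  have h3 : opNorm Δ * (x ⬝ᵥ x) < x ⬝ᵥ blkDiag L *ᵥ x := by
    rw [dotProduct_blkDiag_mulVec, dotProduct, Fintype.sum_prod_type, Finset.mul_sum]
    obtain ⟨⟨i, k⟩, hik⟩ := Function.ne_iff.1 hx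
    refine Finset.sum_lt_sum (fun j _ => ?_) ⟨i, Finset.mem_univ i, ?_⟩
    · by_cases hj : (fun k => x (j, k)) = 0
      · have hj' : ∀ k, x (j, k) = 0 := congrFun hj
        rw [hj]
        simp [hj']
      · exact (hpos j _ hj).le
    · exact hpos i _ fun h => hik (congrFun h k)
  rw [Matrix.sub_mulVec, Matrix.add_mulVec, dotProduct_sub, dotProduct_add]
  linarith

/-- A critical point whose multipliers dominate the noise has rank `d`, and its dual certificate
is positive definite transversally to its range. -/
theorem exists_certificate (i₀ : Fin n) (hΔ : Δ.IsSymm) (hS : StiefelBlocks S)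
    (hL : ∀ i, (L i).IsSymm)
    (hcrit : ∀ i, L i * rowBlk S i = rowBlk ((G * Gᵀ + Δ) * S) i)
    (hpos : ∀ i, ∀ x : Fin d → ℝ, x ≠ 0 → opNorm Δ * (x ⬝ᵥ x) < x ⬝ᵥ L i *ᵥ x) :
    ∃ T : Matrix (Fin n × Fin d) (Fin d) ℝ, StiefelBlocks T ∧ rowBlk T i₀ = 1 ∧
      S * Sᵀ = T * Tᵀ ∧ (blkDiag L - (G * Gᵀ + Δ)) * T = 0 ∧
      ∀ x, 0 ≤ x ⬝ᵥ (blkDiag L - (G * Gᵀ + Δ)) *ᵥ x ∧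
        (x ⬝ᵥ (blkDiag L - (G * Gᵀ + Δ)) *ᵥ x = 0 → ∃ y, x = T *ᵥ y) := by
  set C := blkDiag L - (G * Gᵀ + Δ) with hC
  have hCsymm : Cᵀ = C := by
    rw [hC, Matrix.transpose_sub, (isSymm_blkDiag hL).eq, (isSymm_mul_transpose_add hΔ).eq]
  have hCS : C * S = 0 := by
    have h : ∀ i, rowBlk (C * S) i = 0 := fun i => by
      have : rowBlk (C * S) i =
          rowBlk (blkDiag L * S) i - rowBlk ((G * Gᵀ + Δ) * S) i := by
        rw [hC, Matrix.sub_mul]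
        rfl
      rw [this, rowBlk_blkDiag_mul, hcrit, sub_self]
    ext ⟨i, k⟩ l
    exact congrFun (congrFun (h i) k) l
  have hker : ∀ w, Gᵀ *ᵥ (S *ᵥ w) = 0 → S *ᵥ w = 0 := fun w hw => by
    by_contra hne
    have h := dotProduct_certificate_pos hpos hne hw
    rw [← hC, Matrix.mulVec_mulVec, hCS, Matrix.zero_mulVec, dotProduct_zero] at h
    exact h.false
  set T := S * (rowBlk S i₀)ᵀ with hT
  have hT0 : rowBlk T i₀ = 1 := hS i₀
  have hrow : ∀ (y : Fin d → ℝ) (k : Fin d), (T *ᵥ y) (i₀, k) = y k := fun y k => by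
    have : (T *ᵥ y) (i₀, k) = (rowBlk T i₀ *ᵥ y) k := rfl
    rw [this, hT0, Matrix.one_mulVec]
  have hunit : IsUnit (Gᵀ * T) := by
    rw [← Matrix.mulVec_injective_iff_isUnit]
    refine (injective_iff_map_eq_zero (Matrix.mulVecLin (Gᵀ * T))).2 fun y hy => ?_
    rw [Matrix.mulVecLin_apply, hT, ← Matrix.mulVec_mulVec, ← Matrix.mulVec_mulVec] at hy
    have h := hker _ hy
    rw [Matrix.mulVec_mulVec, ← hT] at h
    ext k
    rw [← hrow y k, h]
    rfl
  have hsurj : ∀ z, ∃ y, Gᵀ *ᵥ (T *ᵥ y) = z := fun z => by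
    obtain ⟨y, hy⟩ := Matrix.mulVec_surjective_iff_isUnit.2 hunit z
    exact ⟨y, by rw [Matrix.mulVec_mulVec, hy]⟩
  have hST : S = T * rowBlk S i₀ := by
    have h : ∀ w, S *ᵥ w = (T * rowBlk S i₀) *ᵥ w := fun w => by
      obtain ⟨y, hy⟩ := hsurj (Gᵀ *ᵥ (S *ᵥ w))
      have h1 : S *ᵥ (w - (rowBlk S i₀)ᵀ *ᵥ y) = 0 := by
        refine hker _ ?_
        rw [Matrix.mulVec_sub, Matrix.mulVec_mulVec, ← hT, Matrix.mulVec_sub, hy, sub_self]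
      rw [Matrix.mulVec_sub, Matrix.mulVec_mulVec, ← hT, sub_eq_zero] at h1
      have h2 : rowBlk S i₀ *ᵥ w = y := by
        ext k
        rw [← hrow y k, ← h1]
        rfl
      rw [← Matrix.mulVec_mulVec, h2, h1]
    exact Matrix.mulVec_injective (funext h)
  have hSS : S * Sᵀ = T * Tᵀ := by
    conv_lhs => rw [hST]
    rw [Matrix.transpose_mul, Matrix.mul_assoc, ← Matrix.mul_assoc (rowBlk S i₀), hS i₀,
      Matrix.one_mul]
  have hCT : C * T = 0 := by rw [hT, ← Matrix.mul_assoc, hCS, Matrix.zero_mul]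
  refine ⟨T, fun i => ?_, hT0, hSS, hCT, fun x => ?_⟩
  · rw [← blk_mul_transpose, ← hSS, blk_mul_transpose, hS i]
  · obtain ⟨y, hy⟩ := hsurj (Gᵀ *ᵥ x)
    have h1 : Gᵀ *ᵥ (x - T *ᵥ y) = 0 := by rw [Matrix.mulVec_sub, hy, sub_self]
    have h2 : x ⬝ᵥ C *ᵥ x = (x - T *ᵥ y) ⬝ᵥ C *ᵥ (x - T *ᵥ y) := by
      have h3 : C *ᵥ (T *ᵥ y) = 0 := by rw [Matrix.mulVec_mulVec, hCT, Matrix.zero_mulVec]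
      have h4 : (T *ᵥ y) ⬝ᵥ C *ᵥ x = 0 := by
        rw [Matrix.dotProduct_mulVec, ← Matrix.mulVec_transpose, hCsymm, h3, zero_dotProduct]
      rw [Matrix.mulVec_sub, h3, sub_zero, sub_dotProduct, h4, sub_zero]
    by_cases hx : x - T *ᵥ y = 0
    · rw [h2, hx]
      simp only [zero_dotProduct, le_refl, true_and]
      exact fun _ => ⟨y, sub_eq_zero.1 hx⟩
    · have h := dotProduct_certificate_pos hpos hx h1
      rw [h2]
      exact ⟨h.le, fun h0 => absurd h0 h.ne'⟩

theorem sdpFeasible_mul_transpose {q : ℕ} {R : Matrix (Fin n × Fin d) (Fin q) ℝ}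
    (hR : StiefelBlocks R) : sdpFeasible (R * Rᵀ) := by
  refine ⟨?_, ?_, fun i => ?_⟩
  · rw [Matrix.IsSymm, Matrix.transpose_mul, Matrix.transpose_transpose]
  · rw [← Matrix.conjTranspose_eq_transpose_of_trivial]
    exact Matrix.posSemidef_self_mul_conjTranspose R
  · rw [blk_mul_transpose, hR i]

/-- A dual certificate that is positive definite transversally to the range of `T` makes `T Tᵀ`
the unique maximizer of the SDP. -/
theorem sdpMaximizer_of_certificate (i₀ : Fin n) {T : Matrix (Fin n × Fin d) (Fin d) ℝ}
    (hT : StiefelBlocks T) (hT0 : rowBlk T i₀ = 1) (hCT : (blkDiag L - A) * T = 0)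
    (hC : ∀ x, 0 ≤ x ⬝ᵥ (blkDiag L - A) *ᵥ x ∧
        (x ⬝ᵥ (blkDiag L - A) *ᵥ x = 0 → ∃ y, x = T *ᵥ y)) :
    sdpMaximizer A (T * Tᵀ) ∧ ∀ Y, sdpMaximizer A Y → Y = T * Tᵀ := by
  have hval : ∀ Y, sdpFeasible Y →
      finner A Y = ∑ i, (L i).trace - finner (blkDiag L - A) Y := fun Y hY => by
    rw [finner_sub_left, finner_blkDiag Y hY.2.2]
    ring
  have hX := sdpFeasible_mul_transpose hT
  have hCX : finner (blkDiag L - A) (T * Tᵀ) = 0 := by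
    rw [← finner_mul_right, hCT]
    simp [finner]
  have hfac : ∀ Y, sdpFeasible Y → ∃ (m : ℕ) (B : Matrix (Fin m) (Fin n × Fin d) ℝ),
      Y = Bᵀ * B ∧ finner (blkDiag L - A) Y = ∑ k, B k ⬝ᵥ (blkDiag L - A) *ᵥ B k :=
    fun Y hY => by
      obtain ⟨m, B, hB⟩ := Matrix.posSemidef_iff_eq_sum_vecMulVec.1 hY.2.1
      simp only [star_trivial] at hB
      refine ⟨m, Matrix.of B, ?_, ?_⟩
      · rw [hB]
        ext a b
        simp [Matrix.mul_apply, Matrix.sum_apply, vecMulVec_apply]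
      · rw [hB, finner_sum_right]
        simp only [finner_vecMulVec]
        rfl
  refine ⟨⟨hX, fun Y hY => ?_⟩, fun Y hY => ?_⟩
  · rw [hval Y hY, hval _ hX, hCX]
    obtain ⟨m, B, -, hB⟩ := hfac Y hY
    have := Finset.sum_nonneg fun k (_ : k ∈ Finset.univ) => (hC (B k)).1
    linarith
  · have h := hY.2 _ hX
    rw [hval Y hY.1, hval _ hX, hCX] at h
    obtain ⟨m, B, hYB, hB⟩ := hfac Y hY.1
    have h0 : ∑ k, B k ⬝ᵥ (blkDiag L - A) *ᵥ B k = 0 :=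
      le_antisymm (by linarith) (Finset.sum_nonneg fun k _ => (hC (B k)).1)
    have h1 := (Finset.sum_eq_zero_iff_of_nonneg fun k _ => (hC (B k)).1).1 h0
    choose y hy using fun k => (hC (B k)).2 (h1 k (Finset.mem_univ k))
    have hBT : B = Matrix.of y * Tᵀ := by
      ext a b
      rw [hy a, Matrix.mulVec, dotProduct, Matrix.mul_apply]
      exact Finset.sum_congr rfl fun j _ => mul_comm _ _
    have hYT : Y = T * (Matrix.of y)ᵀ * Matrix.of y * Tᵀ := by
      rw [hYB, hBT, Matrix.transpose_mul, Matrix.transpose_transpose]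
      simp only [Matrix.mul_assoc]
    have h2 : (Matrix.of y)ᵀ * Matrix.of y = 1 := by
      have h3 : blk Y i₀ i₀ =
          rowBlk T i₀ * ((Matrix.of y)ᵀ * Matrix.of y) * (rowBlk T i₀)ᵀ := by
        rw [hYT, Matrix.mul_assoc T, blk_mul_transpose]
        rfl
      rw [hY.1.2.2, hT0, Matrix.one_mul, Matrix.transpose_one, Matrix.mul_one] at h3
      exact h3.symm
    rw [hYT, Matrix.mul_assoc T, h2, Matrix.mul_one]

theorem rank_mul_transpose_of_rowBlk (i₀ : Fin n) {T : Matrix (Fin n × Fin d) (Fin d) ℝ}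
    (hT0 : rowBlk T i₀ = 1) : (T * Tᵀ).rank = d := by
  have hinj : Function.Injective T.mulVecLin := fun y z h => by
    ext k
    have h1 : ∀ w, (T *ᵥ w) (i₀, k) = w k := fun w => by
      have : (T *ᵥ w) (i₀, k) = (rowBlk T i₀ *ᵥ w) k := rfl
      rw [this, hT0, Matrix.one_mulVec]
    rw [← h1 y, ← h1 z]
    exact congrFun h _
  rw [Matrix.rank_self_mul_transpose, Matrix.rank, LinearMap.finrank_range_of_inj hinj,
    Module.finrank_fin_fun]

theorem exists_isLocalMax (A : Matrix (Fin n × Fin d) (Fin n × Fin d) ℝ) (hdp : d ≤ p) :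
    ∃ S : Matrix (Fin n × Fin d) (Fin p) ℝ, isLocalMax A S := by
  have hclosed : IsClosed {S : Matrix (Fin n × Fin d) (Fin p) ℝ | StiefelBlocks S} := by
    simp only [StiefelBlocks, Set.ofPred_forall]
    refine isClosed_iInter fun i => isClosed_eq ?_ continuous_const
    have : Continuous fun S : Matrix (Fin n × Fin d) (Fin p) ℝ => rowBlk S i :=
      continuous_pi fun k => continuous_pi fun l =>
        (continuous_apply l).comp (continuous_apply (i, k))
    exact this.matrix_mul this.matrix_transpose
  have hsub : {S : Matrix (Fin n × Fin d) (Fin p) ℝ | StiefelBlocks S} ⊆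
      Set.pi Set.univ fun _ => Set.pi Set.univ fun _ => Set.Icc (-1 : ℝ) 1 := by
    rintro S hS ⟨i, k⟩ - l -
    have h := congrFun (congrFun (hS i) k) k
    rw [Matrix.one_apply_eq, Matrix.mul_apply] at h
    have h2 := Finset.single_le_sum (f := fun j => rowBlk S i k j * (rowBlk S i)ᵀ j k)
      (fun j _ => mul_self_nonneg _) (Finset.mem_univ l)
    rw [h] at h2
    refine abs_le.1 ((sq_le_one_iff_abs_le_one _).1 ?_)
    rw [pow_two]
    exact h2
  have hcomp : IsCompact {S : Matrix (Fin n × Fin d) (Fin p) ℝ | StiefelBlocks S} :=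
    (isCompact_univ_pi fun _ => isCompact_univ_pi fun _ => isCompact_Icc).of_isClosed_subset
      hclosed hsub
  have hne : {S : Matrix (Fin n × Fin d) (Fin p) ℝ | StiefelBlocks S}.Nonempty := by
    refine ⟨fun q l => if Fin.castLE hdp q.2 = l then 1 else 0, fun i => ?_⟩
    ext a b
    simp [Matrix.mul_apply, rowBlk, Matrix.one_apply, eq_comm]
  have hcont : Continuous fun S : Matrix (Fin n × Fin d) (Fin p) ℝ => finner A (S * Sᵀ) := by
    have : Continuous fun S : Matrix (Fin n × Fin d) (Fin p) ℝ => S * Sᵀ :=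
      continuous_id.matrix_mul continuous_id.matrix_transpose
    unfold finner
    exact continuous_finsetSum _ fun i _ => continuous_finsetSum _ fun j _ =>
      continuous_const.mul (this.matrix_elem i j)
  obtain ⟨S, hS, hmax⟩ := hcomp.exists_isMaxOn hne hcont.continuousOn
  exact ⟨S, hS, 1, one_pos, fun S' hS' _ => hmax hS'⟩

end Certificate

/-- deterministic benign landscape for the Burer–Monteiro approach. -/
theorem bm_landscape_deterministic {n d p : ℕ} (hn : 2 ≤ n) (hd : 1 ≤ d)
    (hp : 2 * d + 1 ≤ p)
    (Δ : Matrix (Fin n × Fin d) (Fin n × Fin d) ℝ)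
    (hΔsym : Δ.IsSymm) (hΔdiag : ∀ i, blk Δ i i = 0)
    (G : Matrix (Fin n × Fin d) (Fin d) ℝ) (hG : StiefelBlocks G)
    (A : Matrix (Fin n × Fin d) (Fin n × Fin d) ℝ) (hA : A = G * Gᵀ + Δ)
    (κ : ℝ)
    (hκ : κ = (2 + Real.sqrt 5) * ((p : ℝ) + d) / ((p : ℝ) - 2 * d) *
        max (opNorm Δ) (opNorm (partialTrace Δ)))
    (hcond : (n : ℝ) >
        3 * d * κ ^ 2 / (2 * n)
        + Real.sqrt ((d : ℝ) / n) * κ * (⨆ i, opNorm (colBlk Δ i))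
        + (⨆ i, opNorm ((colBlk Δ i)ᵀ * G))
        + opNorm Δ) :
    ∃ X : Matrix (Fin n × Fin d) (Fin n × Fin d) ℝ,
      sdpMaximizer A X ∧ (∀ Y, sdpMaximizer A Y → Y = X) ∧
      X.rank = d ∧
      (∃ R : Matrix (Fin n × Fin d) (Fin d) ℝ, progPMaximizer A R ∧ X = R * Rᵀ) ∧
      ∀ S : Matrix (Fin n × Fin d) (Fin p) ℝ, isLocalMax A S → S * Sᵀ = X := by
  subst hA
  have hn0 : 0 < n := by omega
  have key : ∀ S : Matrix (Fin n × Fin d) (Fin p) ℝ, isLocalMax (G * Gᵀ + Δ) S →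
      ∃ T : Matrix (Fin n × Fin d) (Fin d) ℝ, StiefelBlocks T ∧ S * Sᵀ = T * Tᵀ ∧
        (T * Tᵀ).rank = d ∧ sdpMaximizer (G * Gᵀ + Δ) (T * Tᵀ) ∧
        ∀ Y, sdpMaximizer (G * Gᵀ + Δ) Y → Y = T * Tᵀ := fun S hS => by
    have hfo := hS.first_order (isSymm_mul_transpose_add hΔsym)
    obtain ⟨T, hT, hT0, hST, hCT, hC⟩ := exists_certificate ⟨0, hn0⟩ hΔsym hS.1
      (fun i => (hfo i).1) (fun i => (hfo i).2)
      (fun i x hx => hS.opNorm_mul_lt hn hd hp hG hΔsym hΔdiag hκ hcond i hx)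
    obtain ⟨hmax, huniq⟩ := sdpMaximizer_of_certificate ⟨0, hn0⟩ hT hT0 hCT hC
    exact ⟨T, hT, hST, rank_mul_transpose_of_rowBlk _ hT0, hmax, huniq⟩
  obtain ⟨S₀, hS₀⟩ := exists_isLocalMax (p := p) (G * Gᵀ + Δ) (by omega)
  obtain ⟨T, hT, -, hrank, hmax, huniq⟩ := key S₀ hS₀
  refine ⟨T * Tᵀ, hmax, huniq, hrank,
    ⟨T, ⟨hT, fun R' hR' => hmax.2 _ (sdpFeasible_mul_transpose hR')⟩, rfl⟩, fun S hS => ?_⟩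
  obtain ⟨T', -, hST', -, hmax', -⟩ := key S hS
  rw [hST']
  exact huniq _ hmax'
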